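/- Isometry theorem: let U and V be q-tame persistence modules over ℝ. Then d_i(U, V) = d_b(dgm(U), dgm(V)), i.e., the interleaving distance between U and V equals the bottleneck distance between their undecorated persistence diagrams. -/

import Mathlib

attribute [local instance] Classical.propDecidable

structure PersMod (k : Type) [Field k] (T : Type) [Preorder T] where
  space : T → Type
  [addCommGroup : ∀ t, AddCommGroup (space t)]
  [module : ∀ t, Module k (space t)]
  map : ∀ s t : T, s ≤ t → space s →ₗ[k] space t
  map_id : ∀ t, map t t le_rfl = LinearMap.id
  map_comp : ∀ r s t (h1 : r ≤ s) (h2 : s ≤ t),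
    (map s t h2).comp (map r s h1) = map r t (h1.trans h2)

attribute [instance] PersMod.addCommGroup PersMod.module

def PersIso {k : Type} [Field k] {T : Type} [Preorder T] (U V : PersMod k T) : Prop :=
  ∃ e : ∀ t, U.space t ≃ₗ[k] V.space t,
    ∀ s t (h : s ≤ t),
      (e t).toLinearMap.comp (U.map s t h) = (V.map s t h).comp (e s).toLinearMap

def IsIntervalSet {T : Type} [Preorder T] (J : Set T) : Prop :=
  J.Nonempty ∧ ∀ ⦃r s t : T⦄, r ∈ J → t ∈ J → r ≤ s → s ≤ t → s ∈ J

noncomputable def intervalModule (k : Type) [Field k] (T : Type) [Preorder T]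
    (J : Set T) (hJ : IsIntervalSet J) : PersMod k T where
  space t := PLift (t ∈ J) → k
  addCommGroup := fun _ => inferInstance
  module := fun _ => inferInstance
  map s t _ :=
    { toFun := fun f _ => if hs : s ∈ J then f ⟨hs⟩ else 0
      map_add' := fun f g => by
        funext ht; by_cases hs : s ∈ J <;> simp [hs]
      map_smul' := fun c f => by
        funext ht; by_cases hs : s ∈ J <;> simp [hs] }
  map_id t := by
    refine LinearMap.ext fun f => funext fun ht => ?_
    show (if hs : t ∈ J then f ⟨hs⟩ else 0) = f ht
    rw [dif_pos ht.down]
  map_comp r s t h1 h2 := by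
    refine LinearMap.ext fun f => funext fun ht => ?_
    show (if hs : s ∈ J then (if hr : r ∈ J then f ⟨hr⟩ else 0) else 0)
        = (if hr : r ∈ J then f ⟨hr⟩ else 0)
    by_cases hr : r ∈ J
    · have hs : s ∈ J := hJ.2 hr ht.down h1 h2
      simp [hr, hs]
    · by_cases hs : s ∈ J <;> simp [hr, hs]

noncomputable def dsum {k : Type} [Field k] {T : Type} [Preorder T] {L : Type}
    (V : L → PersMod k T) : PersMod k T where
  space t := DFinsupp (fun ℓ => (V ℓ).space t)
  addCommGroup := fun _ => inferInstance
  module := fun _ => inferInstance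
  map s t h := DFinsupp.mapRange.linearMap (fun ℓ => (V ℓ).map s t h)
  map_id t := by
    show DFinsupp.mapRange.linearMap (fun ℓ => (V ℓ).map t t le_rfl) = LinearMap.id
    have : (fun ℓ => (V ℓ).map t t le_rfl)
        = fun ℓ => (LinearMap.id : (V ℓ).space t →ₗ[k] (V ℓ).space t) :=
      funext fun ℓ => (V ℓ).map_id t
    rw [this]
    exact DFinsupp.mapRange.linearMap_id
  map_comp r s t h1 h2 := by
    show (DFinsupp.mapRange.linearMap (fun ℓ => (V ℓ).map s t h2)).comp
        (DFinsupp.mapRange.linearMap (fun ℓ => (V ℓ).map r s h1))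
      = DFinsupp.mapRange.linearMap (fun ℓ => (V ℓ).map r t (h1.trans h2))
    rw [← DFinsupp.mapRange.linearMap_comp]
    congr 1
    funext ℓ
    exact (V ℓ).map_comp r s t h1 h2

open scoped ENNReal

section Dim

noncomputable def edim (k : Type) [Field k] (M : Type) [AddCommGroup M] [Module k M] : ℕ∞ :=
  Cardinal.toENat (Module.rank k M)

noncomputable def erank {k : Type} [Field k] {M N : Type} [AddCommGroup M] [Module k M]
    [AddCommGroup N] [Module k N] (f : M →ₗ[k] N) : ℕ∞ :=
  edim k (LinearMap.range f)

noncomputable def ecard (S : Type) : ℕ∞ := Cardinal.toENat (Cardinal.mk S)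

end Dim

section Matchings

noncomputable def eDiff (x y : EReal) : ℝ≥0∞ :=
  if x = y then 0
  else if x = ⊤ ∨ x = ⊥ ∨ y = ⊤ ∨ y = ⊥ then ⊤
  else ENNReal.ofReal |x.toReal - y.toReal|

noncomputable def dPt (α β : EReal × EReal) : ℝ≥0∞ :=
  max (eDiff α.1 β.1) (eDiff α.2 β.2)

noncomputable def diagDist (α : EReal × EReal) : ℝ≥0∞ :=
  if α.1 = ⊥ ∨ α.2 = ⊤ then ⊤ else ENNReal.ofReal ((α.2.toReal - α.1.toReal) / 2)

def IsMatching {α β : Type} (M : Set (α × β)) : Prop :=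
  (∀ a b b', (a, b) ∈ M → (a, b') ∈ M → b = b') ∧
  (∀ a a' b, (a, b) ∈ M → (a', b) ∈ M → a = a')

def IsDeltaMatching {α β : Type} (A : α → EReal × EReal) (B : β → EReal × EReal)
    (δ : ℝ≥0∞) : Prop :=
  ∃ M : Set (α × β), IsMatching M ∧
    (∀ p ∈ M, dPt (A p.1) (B p.2) ≤ δ) ∧
    (∀ a, (∀ b, (a, b) ∉ M) → diagDist (A a) ≤ δ) ∧
    (∀ b, (∀ a, (a, b) ∉ M) → diagDist (B b) ≤ δ)

noncomputable def dBottle {α β : Type} (A : α → EReal × EReal) (B : β → EReal × EReal) : ℝ≥0∞ :=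
  sInf {d : ℝ≥0∞ | ∃ δ : ℝ, 0 ≤ δ ∧ IsDeltaMatching A B (ENNReal.ofReal δ) ∧ d = ENNReal.ofReal δ}

end Matchings

section Measure

noncomputable def persIm {k : Type} [Field k] (V : PersMod k ℝ) (a : EReal) (c : ℝ) :
    Submodule k (V.space c) :=
  if h : ∃ a' : ℝ, a = (a' : EReal) ∧ a' ≤ c then
    LinearMap.range (V.map h.choose c h.choose_spec.2)
  else ⊥

noncomputable def persKer {k : Type} [Field k] (V : PersMod k ℝ) (c : ℝ) (d : EReal) :
    Submodule k (V.space c) :=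
  if h : ∃ d' : ℝ, d = (d' : EReal) ∧ c ≤ d' then
    LinearMap.ker (V.map c h.choose h.choose_spec.2)
  else ⊤

noncomputable def persMeasure {k : Type} [Field k] (V : PersMod k ℝ)
    (a : EReal) (b c : ℝ) (d : EReal) : ℕ∞ :=
  edim k
    (↥(persIm V (b : EReal) c ⊓ persKer V c d) ⧸
      Submodule.comap (persIm V (b : EReal) c ⊓ persKer V c d).subtype
        (persIm V a c ⊓ persKer V c d))

end Measure

section Interleaving

def Interleaved (k : Type) [Field k] (U V : PersMod k ℝ) (δ : ℝ) : Prop :=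
  ∃ (φ : ∀ t : ℝ, U.space t →ₗ[k] V.space (t + δ))
    (ψ : ∀ t : ℝ, V.space t →ₗ[k] U.space (t + δ)),
    (∀ s t (h : s ≤ t),
      (φ t).comp (U.map s t h) = (V.map (s + δ) (t + δ) (by linarith)).comp (φ s)) ∧
    (∀ s t (h : s ≤ t),
      (ψ t).comp (V.map s t h) = (U.map (s + δ) (t + δ) (by linarith)).comp (ψ s)) ∧
    (∀ t (h : t ≤ t + δ + δ), (ψ (t + δ)).comp (φ t) = U.map t (t + δ + δ) h) ∧
    (∀ t (h : t ≤ t + δ + δ), (φ (t + δ)).comp (ψ t) = V.map t (t + δ + δ) h)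

noncomputable def dInter (k : Type) [Field k] (U V : PersMod k ℝ) : ℝ≥0∞ :=
  sInf {d : ℝ≥0∞ | ∃ δ : ℝ, 0 ≤ δ ∧ Interleaved k U V δ ∧ d = ENNReal.ofReal δ}

def QTame (k : Type) [Field k] (V : PersMod k ℝ) : Prop :=
  ∀ s t : ℝ, ∀ h : s < t, erank (V.map s t h.le) ≠ ⊤

def LocFinitePM (k : Type) [Field k] (W : PersMod k ℝ) : Prop :=
  ∃ (L : Type) (J : L → Set ℝ) (hJ : ∀ ℓ, IsIntervalSet (J ℓ)),
    PersIso W (dsum fun ℓ => intervalModule k ℝ (J ℓ) (hJ ℓ)) ∧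
    ∀ S : Set ℝ, Bornology.IsBounded S → {ℓ : L | (J ℓ ∩ S).Nonempty}.Finite

noncomputable def zeroPers (k : Type) [Field k] : PersMod k ℝ where
  space _ := PUnit
  addCommGroup := fun _ => inferInstance
  module := fun _ => inferInstance
  map _ _ _ := 0
  map_id t := LinearMap.ext fun x => Subsingleton.elim _ _
  map_comp r s t h1 h2 := LinearMap.ext fun x => Subsingleton.elim _ _

noncomputable def smoothing {k : Type} [Field k] (V : PersMod k ℝ) (ε : ℝ) (hε : 0 < ε) :
    PersMod k ℝ where
  space t := LinearMap.range (V.map (t - ε) (t + ε) (by linarith))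
  addCommGroup := fun _ => inferInstance
  module := fun _ => inferInstance
  map s t h := LinearMap.restrict (V.map (s + ε) (t + ε) (by linarith))
    (p := LinearMap.range (V.map (s - ε) (s + ε) (by linarith)))
    (q := LinearMap.range (V.map (t - ε) (t + ε) (by linarith)))
    (by
      rintro x ⟨y, rfl⟩
      refine ⟨V.map (s - ε) (t - ε) (by linarith) y, ?_⟩
      have h1 := LinearMap.congr_fun
        (V.map_comp (s - ε) (t - ε) (t + ε) (by linarith) (by linarith)) y
      have h2 := LinearMap.congr_fun
        (V.map_comp (s - ε) (s + ε) (t + ε) (by linarith) (by linarith)) y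
      simp only [LinearMap.comp_apply] at h1 h2
      rw [h1, h2])
  map_id t := by
    refine LinearMap.ext fun x => Subtype.ext ?_
    have := LinearMap.congr_fun (V.map_id (t + ε)) x.1
    simpa [LinearMap.restrict_apply] using this
  map_comp r s t h1 h2 := by
    refine LinearMap.ext fun x => Subtype.ext ?_
    have := LinearMap.congr_fun
      (V.map_comp (r + ε) (s + ε) (t + ε) (by linarith) (by linarith)) x.1
    simpa [LinearMap.restrict_apply] using this

end Interleaving

section Webb

def webbSubmodule (k : Type) [Field k] (t : ℤ) : Submodule k (ℕ → k) where
  carrier := {x | ∀ i : ℕ, (i : ℤ) < -t → x i = 0}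
  add_mem' := by
    intro x y hx hy i hi
    simp [Pi.add_apply, hx i hi, hy i hi]
  zero_mem' := by
    intro i hi
    rfl
  smul_mem' := by
    intro c x hx i hi
    simp [Pi.smul_apply, hx i hi]

noncomputable def webbModule (k : Type) [Field k] : PersMod k ↥{n : ℤ | n ≤ 0} where
  space t := ↥(webbSubmodule k t.1)
  addCommGroup := fun _ => inferInstance
  module := fun _ => inferInstance
  map s t h := Submodule.inclusion (by
    intro x hx
    have hx' : ∀ i : ℕ, (i : ℤ) < -s.1 → x i = 0 := hx
    intro i hi
    exact hx' i (lt_of_lt_of_le hi (neg_le_neg h)))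
  map_id t := LinearMap.ext fun x => rfl
  map_comp r s t h1 h2 := LinearMap.ext fun x => rfl

end Webb

section Decorated

/-- `decMem t x` : the real number `t` belongs to the interval described by the
decorated pair `x = ((p, εp), (q, εq))`, where the decoration `false` means `⁻`
and `true` means `⁺`. -/
def decMem (t : ℝ) (x : (EReal × Bool) × (EReal × Bool)) : Prop :=
  (x.1.1 < (t : EReal) ∨ (x.1.1 = (t : EReal) ∧ x.1.2 = false)) ∧
  ((t : EReal) < x.2.1 ∨ ((t : EReal) = x.2.1 ∧ x.2.2 = true))

/-- A valid decorated pair: the left coordinate is `p⁻`/`p⁺` for a real `p` or `−∞⁺`,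
the right coordinate is `q⁻`/`q⁺` for a real `q` or `+∞⁻`, and the corresponding
interval is nonempty (i.e. `p* < q*`). -/
def ValidDec (x : (EReal × Bool) × (EReal × Bool)) : Prop :=
  (x.1.1 = ⊥ → x.1.2 = true) ∧ x.1.1 ≠ ⊤ ∧ (x.2.1 = ⊤ → x.2.2 = false) ∧ x.2.1 ≠ ⊥ ∧
  {t : ℝ | decMem t x}.Nonempty

/-- The decorated pair `x` belongs to the rectangle `[a,b] × [c,d]`, i.e.
`[b,c] ⊆ ⟨p*,q*⟩ ⊆ (a,d)`. -/
def decInRect (x : (EReal × Bool) × (EReal × Bool)) (a : EReal) (b c : ℝ) (d : EReal) : Prop :=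
  (∀ t ∈ Set.Icc b c, decMem t x) ∧
  (∀ t : ℝ, decMem t x → a < (t : EReal) ∧ (t : EReal) < d)

/-- `Dgm` is (a labelling of) the decorated persistence diagram of `V`. -/
def IsDgmOf {k : Type} [Field k] (V : PersMod k ℝ) {ι : Type}
    (Dgm : ι → (EReal × Bool) × (EReal × Bool)) : Prop :=
  (∀ i, ValidDec (Dgm i)) ∧
  ∀ (a : EReal) (b c : ℝ) (d : EReal), a < (b : EReal) → b ≤ c → (c : EReal) < d →
    persMeasure V a b c d = ecard {i : ι // decInRect (Dgm i) a b c d}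

end Decorated

section RMeasure

/-- `[a,b] × [c,d]` is a (nondegenerate) rectangle contained in `D`. -/
def RectIn (D : Set (ℝ × ℝ)) (a b c d : ℝ) : Prop :=
  a < b ∧ c < d ∧ Set.Icc a b ×ˢ Set.Icc c d ⊆ D

/-- An r-measure on `D`: additivity under horizontal and vertical splitting. -/
def IsRMeasure (D : Set (ℝ × ℝ)) (μ : ℝ → ℝ → ℝ → ℝ → ℕ∞) : Prop :=
  (∀ a p b c d, a < p → p < b → RectIn D a b c d → μ a b c d = μ a p c d + μ p b c d) ∧
  (∀ a b c q d, c < q → q < d → RectIn D a b c d → μ a b c d = μ a b c q + μ a b q d)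

/-- Membership of a decorated point of the plane (`Bool` decoration: `true` = `⁺`,
`false` = `⁻`) in the closed rectangle `[a,b] × [c,d]`. -/
def dptMem (x : (ℝ × Bool) × (ℝ × Bool)) (a b c d : ℝ) : Prop :=
  a ≤ x.1.1 ∧ x.1.1 ≤ b ∧ c ≤ x.2.1 ∧ x.2.1 ≤ d ∧
  (x.1.1 = a → x.1.2 = true) ∧ (x.1.1 = b → x.1.2 = false) ∧
  (x.2.1 = c → x.2.2 = true) ∧ (x.2.1 = d → x.2.2 = false)

/-- The r-interior `D•` of `D`: decorated points contained in some rectangle of `D`. -/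
def rInt (D : Set (ℝ × ℝ)) : Set ((ℝ × Bool) × (ℝ × Bool)) :=
  {x | ∃ a b c d, RectIn D a b c d ∧ dptMem x a b c d}

/-- The number of decorated points, counted with multiplicity `m`, lying in the
rectangle `[a,b] × [c,d]`. -/
noncomputable def dcount (m : (ℝ × Bool) × (ℝ × Bool) → ℕ) (a b c d : ℝ) : ℕ∞ :=
  ecard (Σ x : {x : (ℝ × Bool) × (ℝ × Bool) // dptMem x a b c d}, Fin (m x.1))

end RMeasure

section Basics

theorem PersMod.map_map {k : Type} [Field k] {T : Type} [Preorder T] (V : PersMod k T)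
    {r s t : T} (h1 : r ≤ s) (h2 : s ≤ t) (x : V.space r) :
    V.map s t h2 (V.map r s h1 x) = V.map r t (h1.trans h2) x :=
  LinearMap.congr_fun (V.map_comp r s t h1 h2) x

theorem PersMod.map_self {k : Type} [Field k] {T : Type} [Preorder T] (V : PersMod k T)
    {t : T} (h : t ≤ t) (x : V.space t) : V.map t t h x = x :=
  LinearMap.congr_fun (V.map_id t) x

/-- Pointwise constructor for interleavings. -/
theorem Interleaved.mk' {k : Type} [Field k] {U V : PersMod k ℝ} {δ : ℝ}
    (φ : ∀ t : ℝ, U.space t →ₗ[k] V.space (t + δ))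
    (ψ : ∀ t : ℝ, V.space t →ₗ[k] U.space (t + δ))
    (h1 : ∀ s t (h : s ≤ t) (h' : s + δ ≤ t + δ) x,
      φ t (U.map s t h x) = V.map (s + δ) (t + δ) h' (φ s x))
    (h2 : ∀ s t (h : s ≤ t) (h' : s + δ ≤ t + δ) x,
      ψ t (V.map s t h x) = U.map (s + δ) (t + δ) h' (ψ s x))
    (h3 : ∀ t (h : t ≤ t + δ + δ) x, ψ (t + δ) (φ t x) = U.map t (t + δ + δ) h x)
    (h4 : ∀ t (h : t ≤ t + δ + δ) x, φ (t + δ) (ψ t x) = V.map t (t + δ + δ) h x) :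
    Interleaved k U V δ :=
  ⟨φ, ψ, fun s t h => LinearMap.ext fun x => h1 s t h (by linarith) x,
    fun s t h => LinearMap.ext fun x => h2 s t h (by linarith) x,
    fun t h => LinearMap.ext fun x => h3 t h x, fun t h => LinearMap.ext fun x => h4 t h x⟩

theorem Interleaved.symm' {k : Type} [Field k] {U V : PersMod k ℝ} {δ : ℝ}
    (h : Interleaved k U V δ) : Interleaved k V U δ := by
  obtain ⟨φ, ψ, h1, h2, h3, h4⟩ := h
  exact ⟨ψ, φ, h2, h1, h4, h3⟩

theorem Interleaved.trans' {k : Type} [Field k] {U V W : PersMod k ℝ} {δ ε : ℝ}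
    (hδ : 0 ≤ δ) (hε : 0 ≤ ε)
    (h : Interleaved k U V δ) (h' : Interleaved k V W ε) : Interleaved k U W (δ + ε) := by
  obtain ⟨φ, ψ, h1, h2, h3, h4⟩ := h
  obtain ⟨φ', ψ', h1', h2', h3', h4'⟩ := h'
  have h1 := fun s t h x => LinearMap.congr_fun (h1 s t h) x
  have h2 := fun s t h x => LinearMap.congr_fun (h2 s t h) x
  have h3 := fun t h x => LinearMap.congr_fun (h3 t h) x
  have h4 := fun t h x => LinearMap.congr_fun (h4 t h) x
  have h1' := fun s t h x => LinearMap.congr_fun (h1' s t h) x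
  have h2' := fun s t h x => LinearMap.congr_fun (h2' s t h) x
  have h3' := fun t h x => LinearMap.congr_fun (h3' t h) x
  have h4' := fun t h x => LinearMap.congr_fun (h4' t h) x
  simp only [LinearMap.comp_apply] at h1 h2 h3 h4 h1' h2' h3' h4'
  refine Interleaved.mk'
    (fun t => (W.map (t + δ + ε) (t + (δ + ε)) (by linarith)) ∘ₗ (φ' (t + δ)) ∘ₗ (φ t))
    (fun t => (U.map (t + ε + δ) (t + (δ + ε)) (by linarith)) ∘ₗ (ψ (t + ε)) ∘ₗ (ψ' t))
    ?_ ?_ ?_ ?_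
  · intro s t h h' x
    simp only [LinearMap.comp_apply]
    rw [h1, h1', W.map_map, W.map_map]
  · intro s t h h' x
    simp only [LinearMap.comp_apply]
    rw [h2', h2, U.map_map, U.map_map]
  · intro t h x
    simp only [LinearMap.comp_apply]
    rw [h2' (t + δ + ε) (t + (δ + ε)) (by linarith), h3' (t + δ) (by linarith), V.map_map,
      h2 (t + δ) _ (by linarith), h3 t (by linarith), U.map_map, U.map_map]
  · intro t h x
    simp only [LinearMap.comp_apply]
    rw [h1 (t + ε + δ) (t + (δ + ε)) (by linarith), h4 (t + ε) (by linarith), V.map_map,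
      h1' (t + ε) _ (by linarith), h4' t (by linarith), W.map_map, W.map_map]

theorem interleaved_zero_of_iso {k : Type} [Field k] {U V : PersMod k ℝ}
    (h : PersIso U V) : Interleaved k U V 0 := by
  obtain ⟨e, he⟩ := h
  have he := fun s t h x => LinearMap.congr_fun (he s t h) x
  simp only [LinearMap.comp_apply, LinearEquiv.coe_coe] at he
  have he' : ∀ s t h x, (e t).symm (V.map s t h x) = U.map s t h ((e s).symm x) := by
    intro s t h x
    rw [LinearEquiv.symm_apply_eq, he, LinearEquiv.apply_symm_apply]
  refine Interleaved.mk'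
    (fun t => (V.map t (t + 0) (by linarith)) ∘ₗ (e t).toLinearMap)
    (fun t => (U.map t (t + 0) (by linarith)) ∘ₗ (e t).symm.toLinearMap) ?_ ?_ ?_ ?_
  · intro s t h h' x
    simp only [LinearMap.comp_apply, LinearEquiv.coe_coe]
    rw [he, V.map_map, V.map_map]
  · intro s t h h' x
    simp only [LinearMap.comp_apply, LinearEquiv.coe_coe]
    rw [he', U.map_map, U.map_map]
  · intro t h x
    simp only [LinearMap.comp_apply, LinearEquiv.coe_coe]
    rw [he', LinearEquiv.symm_apply_apply, U.map_map]
  · intro t h x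
    simp only [LinearMap.comp_apply, LinearEquiv.coe_coe]
    rw [he, LinearEquiv.apply_symm_apply, V.map_map]

theorem interleaved_smoothing {k : Type} [Field k] (V : PersMod k ℝ) (ε : ℝ) (hε : 0 < ε) :
    Interleaved k V (smoothing V ε hε) ε := by
  have key : ∀ s t (h : s ≤ t) (x : (smoothing V ε hε).space s),
      ((smoothing V ε hε).map s t h x).1 = V.map (s + ε) (t + ε) (by linarith) x.1 :=
    fun s t h x => rfl
  refine Interleaved.mk'
    (fun t => (V.map (t + ε - ε) (t + ε + ε) (by linarith)).rangeRestrict ∘ₗ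
      (V.map t (t + ε - ε) (by linarith)))
    (fun t => (LinearMap.range (V.map (t - ε) (t + ε) (by linarith))).subtype) ?_ ?_ ?_ ?_
  · intro s t h h' x
    apply Subtype.ext
    show V.map (t + ε - ε) (t + ε + ε) _ (V.map t (t + ε - ε) _ (V.map s t h x))
      = V.map (s + ε + ε) (t + ε + ε) _
        (V.map (s + ε - ε) (s + ε + ε) _ (V.map s (s + ε - ε) _ x))
    simp only [V.map_map]
  · intro s t h h' x
    rfl
  · intro t h x
    show V.map (t + ε - ε) (t + ε + ε) _ (V.map t (t + ε - ε) _ x) = _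
    rw [V.map_map]
  · intro t h x
    apply Subtype.ext
    show V.map (t + ε + ε - ε) (t + ε + ε + ε) _ (V.map (t + ε) (t + ε + ε - ε) _ x.1)
      = V.map (t + ε) (t + ε + ε + ε) _ x.1
    rw [V.map_map]

/-- Restriction along a monotone map. -/
def pullMod {k : Type} [Field k] {S T : Type} [Preorder S] [Preorder T] (V : PersMod k T)
    (f : S → T) (hf : Monotone f) : PersMod k S where
  space s := V.space (f s)
  addCommGroup := fun _ => inferInstance
  module := fun _ => inferInstance
  map s t h := V.map (f s) (f t) (hf h)
  map_id t := V.map_id _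
  map_comp r s t h1 h2 := V.map_comp _ _ _ _ _

theorem interleaved_pull {k : Type} [Field k] (V : PersMod k ℝ) (ε : ℝ)
    (f : ℝ → ℝ) (hf : Monotone f) (h1 : ∀ t, f t ≤ t + ε) (h2 : ∀ t, t ≤ f (t + ε)) :
    Interleaved k V (pullMod V f hf) ε := by
  refine Interleaved.mk' (V := pullMod V f hf)
    (fun t => V.map t (f (t + ε)) (h2 t)) (fun t => V.map (f t) (t + ε) (h1 t)) ?_ ?_ ?_ ?_
  · intro s t h h' x
    exact (V.map_map h (h2 t) x).trans (V.map_map (h2 s) (hf h') x).symm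
  · intro s t h h' x
    exact (V.map_map (hf h) (h1 t) x).trans (V.map_map (h1 s) h' x).symm
  · intro t h x
    exact V.map_map (h2 t) (h1 (t + ε)) x
  · intro t h x
    exact V.map_map (h1 t) (h2 (t + ε)) x

end Basics

section Bars

/-- The span of the bars alive at `t`. -/
noncomputable def barSp (k : Type) [Field k] {T L : Type} (J : L → Set T) (t : T) :
    Submodule k (L →₀ k) where
  carrier := {f | ∀ ℓ, t ∉ J ℓ → f ℓ = 0}
  add_mem' := by
    intro a b ha hb ℓ hℓ
    simp [ha ℓ hℓ, hb ℓ hℓ]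
  zero_mem' := by intro ℓ _; rfl
  smul_mem' := by
    intro c a ha ℓ hℓ
    simp [ha ℓ hℓ]

theorem mem_barSp {k : Type} [Field k] {T L : Type} {J : L → Set T} {t : T} {f : L →₀ k} :
    f ∈ barSp k J t ↔ ∀ ℓ, t ∉ J ℓ → f ℓ = 0 := Iff.rfl

/-- Project to the bars alive at `t`. -/
noncomputable def barProj (k : Type) [Field k] {T L : Type} (J : L → Set T) (t : T) :
    (L →₀ k) →ₗ[k] barSp k J t where
  toFun f := ⟨f.filter (fun ℓ => t ∈ J ℓ), fun ℓ hℓ => Finsupp.filter_apply_neg _ _ hℓ⟩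
  map_add' f g := Subtype.ext Finsupp.filter_add
  map_smul' c f := Subtype.ext Finsupp.filter_smul

theorem barProj_apply {k : Type} [Field k] {T L : Type} (J : L → Set T) (t : T)
    (f : L →₀ k) (ℓ : L) : (barProj k J t f).1 ℓ = if t ∈ J ℓ then f ℓ else 0 :=
  Finsupp.filter_apply _ _ _

/-- The persistence module with a given barcode. -/
noncomputable def barMod (k : Type) [Field k] {T L : Type} [Preorder T] (J : L → Set T)
    (hJ : ∀ ℓ, (J ℓ).OrdConnected) : PersMod k T where
  space t := barSp k J t
  addCommGroup := fun _ => inferInstance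
  module := fun _ => inferInstance
  map s t _ := barProj k J t ∘ₗ (barSp k J s).subtype
  map_id t := by
    refine LinearMap.ext fun f => Subtype.ext (Finsupp.ext fun ℓ => ?_)
    show (barProj k J t f.1).1 ℓ = f.1 ℓ
    rw [barProj_apply]
    split_ifs with h
    · rfl
    · exact (f.2 ℓ h).symm
  map_comp r s t h1 h2 := by
    refine LinearMap.ext fun f => Subtype.ext (Finsupp.ext fun ℓ => ?_)
    show (barProj k J t (barProj k J s f.1).1).1 ℓ = (barProj k J t f.1).1 ℓ
    rw [barProj_apply, barProj_apply, barProj_apply]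
    split_ifs with h h'
    · rfl
    · by_contra hne
      exact h' ((hJ ℓ).out (by
        by_contra hr
        exact hne (f.2 ℓ hr).symm) h ⟨h1, h2⟩)
    · rfl

theorem barMod_map_apply {k : Type} [Field k] {T L : Type} [Preorder T] (J : L → Set T)
    (hJ : ∀ ℓ, (J ℓ).OrdConnected) {s t : T} (h : s ≤ t) (f : (barMod k J hJ).space s) (ℓ : L) :
    Subtype.val (p := (· ∈ barSp k J t)) ((barMod k J hJ).map s t h f) ℓ
      = if t ∈ J ℓ then Subtype.val (p := (· ∈ barSp k J s)) f ℓ else 0 :=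
  barProj_apply J t _ ℓ

/-- Two sets of reals are `δ`-close, in terms of their ends. -/
def NearSet (δ : ℝ) (I I' : Set ℝ) : Prop :=
  (∀ s ∈ I, (∃ u ∈ I', u ≤ s + δ) ∧ (∃ u ∈ I', s ≤ u + δ)) ∧
  (∀ s ∈ I', (∃ u ∈ I, u ≤ s + δ) ∧ (∃ u ∈ I, s ≤ u + δ))

/-- The linear map induced by a relation. -/
noncomputable def matchMap (k : Type) [Field k] {L L' : Type} (M : Set (L × L')) :
    (L →₀ k) →ₗ[k] (L' →₀ k) :=
  Finsupp.linearCombination k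
    (fun ℓ => if h : ∃ ℓ', (ℓ, ℓ') ∈ M then Finsupp.single h.choose (1 : k) else 0)

theorem matchMap_apply_mem {k : Type} [Field k] {L L' : Type} {M : Set (L × L')}
    (hM : IsMatching M) {ℓ : L} {ℓ' : L'} (h : (ℓ, ℓ') ∈ M) (f : L →₀ k) :
    matchMap k M f ℓ' = f ℓ := by
  induction f using Finsupp.induction_linear with
  | zero => simp
  | add f g hf hg => simp [hf, hg]
  | single a b =>
    simp only [matchMap, Finsupp.linearCombination_single]
    by_cases ha : ∃ ℓ'', (a, ℓ'') ∈ M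
    · rw [dif_pos ha]
      by_cases hal : a = ℓ
      · subst hal
        have : ha.choose = ℓ' := hM.1 _ _ _ ha.choose_spec h
        simp [this]
      · have : ha.choose ≠ ℓ' := by
          intro h2
          exact hal (hM.2 _ _ _ (h2 ▸ ha.choose_spec) h)
        simp [Finsupp.single_apply, this, hal]
    · have hal : a ≠ ℓ := by
        rintro rfl
        exact ha ⟨_, h⟩
      rw [dif_neg ha]
      simp [Finsupp.single_apply, hal]

theorem matchMap_apply_not {k : Type} [Field k] {L L' : Type} {M : Set (L × L')}
    {ℓ' : L'} (h : ∀ ℓ, (ℓ, ℓ') ∉ M) (f : L →₀ k) :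
    matchMap k M f ℓ' = 0 := by
  induction f using Finsupp.induction_linear with
  | zero => simp
  | add f g hf hg => simp [hf, hg]
  | single a b =>
    simp only [matchMap, Finsupp.linearCombination_single]
    by_cases ha : ∃ ℓ'', (a, ℓ'') ∈ M
    · rw [dif_pos ha]
      have : ha.choose ≠ ℓ' := by
        intro h2
        exact h a (h2 ▸ ha.choose_spec)
      simp [Finsupp.single_apply, this]
    · rw [dif_neg ha]
      simp

theorem NearSet.symm {δ : ℝ} {I I' : Set ℝ} (h : NearSet δ I I') : NearSet δ I' I := ⟨h.2, h.1⟩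

theorem match_nat {k : Type} [Field k] {L L' : Type} (J : L → Set ℝ) (J' : L' → Set ℝ)
    (hJ : ∀ ℓ, (J ℓ).OrdConnected) (hJ' : ∀ ℓ, (J' ℓ).OrdConnected) {δ : ℝ}
    (M : Set (L × L')) (hM : IsMatching M)
    (hnear : ∀ p ∈ M, NearSet δ (J p.1) (J' p.2))
    (s t : ℝ) (h : s ≤ t) (h' : s + δ ≤ t + δ) (x : barSp k J s) :
    barProj k J' (t + δ) (matchMap k M (barProj k J t x.1).1)
    = barProj k J' (t + δ) (barProj k J' (s + δ) (matchMap k M x.1)).1 := by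
  refine Subtype.ext (Finsupp.ext fun b => ?_)
  rw [barProj_apply, barProj_apply, barProj_apply]
  by_cases ht : t + δ ∈ J' b
  swap
  · simp [ht]
  rw [if_pos ht, if_pos ht]
  by_cases hb : ∃ a, (a, b) ∈ M
  swap
  · push Not at hb
    rw [matchMap_apply_not hb, matchMap_apply_not hb]
    simp
  obtain ⟨a, hab⟩ := hb
  rw [matchMap_apply_mem hM hab, matchMap_apply_mem hM hab, barProj_apply]
  have hn := hnear _ hab
  by_cases hs : s ∈ J a
  · have h1 : t ∈ J a := by
      obtain ⟨u, hu, hu'⟩ := (hn.2 _ ht).2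
      exact (hJ a).out hs hu ⟨h, by linarith⟩
    have h2 : s + δ ∈ J' b := by
      obtain ⟨u, hu, hu'⟩ := (hn.1 _ hs).1
      exact (hJ' b).out hu ht ⟨hu', h'⟩
    rw [if_pos h1, if_pos h2]
  · have : x.1 a = 0 := x.2 a hs
    rw [this]
    simp

theorem match_comp {k : Type} [Field k] {L L' : Type} (J : L → Set ℝ) (J' : L' → Set ℝ)
    (hJ : ∀ ℓ, (J ℓ).OrdConnected) (hJ' : ∀ ℓ, (J' ℓ).OrdConnected) {δ : ℝ} 
    (M : Set (L × L')) (hM : IsMatching M) (M' : Set (L' × L)) (hM' : IsMatching M')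
    (hMM : ∀ a b, (a, b) ∈ M ↔ (b, a) ∈ M')
    (hnear : ∀ p ∈ M, NearSet δ (J p.1) (J' p.2))
    (hun : ∀ a, (∀ b, (a, b) ∉ M) → ∀ t, t ∈ J a → t + δ + δ ∉ J a)
    (t : ℝ) (h : t ≤ t + δ + δ) (x : barSp k J t) :
    barProj k J (t + δ + δ) (matchMap k M' (barProj k J' (t + δ) (matchMap k M x.1)).1)
    = barProj k J (t + δ + δ) x.1 := by
  refine Subtype.ext (Finsupp.ext fun a => ?_)
  rw [barProj_apply, barProj_apply]
  by_cases ht2 : t + δ + δ ∈ J a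
  swap
  · simp [ht2]
  rw [if_pos ht2, if_pos ht2]
  by_cases ha : ∃ b, (a, b) ∈ M
  · obtain ⟨b, hab⟩ := ha
    rw [matchMap_apply_mem hM' ((hMM a b).1 hab), barProj_apply, matchMap_apply_mem hM hab]
    by_cases ht : t ∈ J a
    · have hn := hnear _ hab
      have : t + δ ∈ J' b := by
        obtain ⟨u, hu, hu'⟩ := (hn.1 _ ht).1
        obtain ⟨v, hv, hv'⟩ := (hn.1 _ ht2).2
        exact (hJ' b).out hu hv ⟨hu', by linarith⟩
      rw [if_pos this]
    · have : x.1 a = 0 := x.2 a ht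
      rw [this]
      simp
  · push Not at ha
    rw [matchMap_apply_not (fun b hb => ha b ((hMM a b).2 hb))]
    have : t ∉ J a := fun h => hun a ha t h ht2
    exact (x.2 a this).symm

/-- A matching of barcodes induces an interleaving. -/
theorem interleaved_of_matching {k : Type} [Field k] {L L' : Type} (J : L → Set ℝ)
    (J' : L' → Set ℝ)
    (hJ : ∀ ℓ, (J ℓ).OrdConnected) (hJ' : ∀ ℓ, (J' ℓ).OrdConnected) {δ : ℝ} 
    (M : Set (L × L')) (hM : IsMatching M)
    (hnear : ∀ p ∈ M, NearSet δ (J p.1) (J' p.2))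
    (hun : ∀ a, (∀ b, (a, b) ∉ M) → ∀ t, t ∈ J a → t + δ + δ ∉ J a)
    (hun' : ∀ b, (∀ a, (a, b) ∉ M) → ∀ t, t ∈ J' b → t + δ + δ ∉ J' b) :
    Interleaved k (barMod k J hJ) (barMod k J' hJ') δ := by
  set M' : Set (L' × L) := {p | (p.2, p.1) ∈ M} with hM'def
  have hM' : IsMatching M' :=
    ⟨fun a b b' h h' => hM.2 _ _ _ h h', fun a a' b h h' => hM.1 _ _ _ h h'⟩
  exact Interleaved.mk'
    (fun t => barProj k J' (t + δ) ∘ₗ matchMap k M ∘ₗ (barSp k J t).subtype)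
    (fun t => barProj k J (t + δ) ∘ₗ matchMap k M' ∘ₗ (barSp k J' t).subtype)
    (match_nat J J' hJ hJ' M hM hnear)
    (match_nat J' J hJ' hJ M' hM' (fun p hp => (hnear (p.2, p.1) hp).symm))
    (match_comp J J' hJ hJ' M hM M' hM' (fun a b => Iff.rfl) hnear hun)
    (match_comp J' J hJ' hJ M' hM' M hM (fun a b => Iff.rfl)
      (fun p hp => (hnear (p.2, p.1) hp).symm) hun')

end Bars

section Decomp

theorem PersIso.symm' {k : Type} [Field k] {T : Type} [Preorder T] {U V : PersMod k T}
    (h : PersIso U V) : PersIso V U := by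
  obtain ⟨e, he⟩ := h
  refine ⟨fun t => (e t).symm, fun s t h => LinearMap.ext fun x => ?_⟩
  have := LinearMap.congr_fun (he s t h) ((e s).symm x)
  simp only [LinearMap.comp_apply, LinearEquiv.coe_coe, LinearEquiv.apply_symm_apply] at this ⊢
  rw [← this, LinearEquiv.symm_apply_apply]

/-- Families that are compatible from time `β` on. -/
def dX {k : Type} [Field k] (W : PersMod k ℤ) (β : WithBot ℤ) :
    Submodule k (∀ n, W.space n) where
  carrier := {x | ∀ (m n : ℤ) (h : m ≤ n), β ≤ (m : WithBot ℤ) → W.map m n h (x m) = x n}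
  add_mem' := by
    intro a b ha hb m n h hm
    simp [ha m n h hm, hb m n h hm]
  zero_mem' := by intro m n h hm; simp
  smul_mem' := by
    intro c a ha m n h hm
    simp [ha m n h hm]

/-- Families that vanish from time `d` on. -/
def dZ {k : Type} [Field k] (W : PersMod k ℤ) (d : WithTop ℤ) :
    Submodule k (∀ n, W.space n) where
  carrier := {x | ∀ n : ℤ, d ≤ (n : WithTop ℤ) → x n = 0}
  add_mem' := by
    intro a b ha hb n hn
    simp [ha n hn, hb n hn]
  zero_mem' := by intro n hn; rfl
  smul_mem' := by
    intro c a ha n hn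
    simp [ha n hn]

theorem dX_mono {k : Type} [Field k] (W : PersMod k ℤ) : Monotone (dX W) :=
  fun _ _ h _ hx m n hmn hm => hx m n hmn (h.trans hm)

theorem dZ_mono {k : Type} [Field k] (W : PersMod k ℤ) : Monotone (dZ W) :=
  fun _ _ h _ hx n hn => hx n (h.trans hn)

/-- Lower part of the double filtration. -/
def dN {k : Type} [Field k] (W : PersMod k ℤ) (β : WithBot ℤ) (d : WithTop ℤ) :
    Submodule k (∀ n, W.space n) :=
  ((⨆ β' < β, dX W β') ⊓ dZ W d) ⊔ ⨆ d' < d, (dX W β ⊓ dZ W d')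

theorem iSup_dX_le {k : Type} [Field k] (W : PersMod k ℤ) (β : WithBot ℤ) :
    (⨆ β' < β, dX W β') ≤ dX W β :=
  iSup₂_le fun _ h => dX_mono W h.le

theorem iSup_dXZ_le {k : Type} [Field k] (W : PersMod k ℤ) (β : WithBot ℤ) (d : WithTop ℤ) :
    (⨆ d' < d, (dX W β ⊓ dZ W d')) ≤ dX W β ⊓ dZ W d :=
  iSup₂_le fun _ h => inf_le_inf le_rfl (dZ_mono W h.le)

theorem dN_le {k : Type} [Field k] (W : PersMod k ℤ) (β : WithBot ℤ) (d : WithTop ℤ) :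
    dN W β d ≤ dX W β ⊓ dZ W d :=
  sup_le (inf_le_inf (iSup_dX_le W β) le_rfl) (iSup_dXZ_le W β d)

theorem inj_of_ker {k M N : Type} [Field k] [AddCommGroup M] [Module k M] [AddCommGroup N]
    [Module k N] (S : Submodule k M) (F : S →ₗ[k] N) (h : ∀ x, F x = 0 → x = 0) : Function.Injective F :=
  (injective_iff_map_eq_zero F).2 h

theorem exists_rel_compl {k P : Type} [Field k] [AddCommGroup P] [Module k P]
    {N F : Submodule k P} (h : N ≤ F) :
    ∃ C : Submodule k P, N ⊓ C = ⊥ ∧ N ⊔ C = F := by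
  obtain ⟨C, hC⟩ := exists_isCompl N
  refine ⟨C ⊓ F, ?_, ?_⟩
  · rw [← inf_assoc, hC.inf_eq_bot, bot_inf_eq]
  · rw [← sup_inf_assoc_of_le C h, hC.sup_eq_top, top_inf_eq]

/-- Mittag-Leffler: an element of a far image extends to a family compatible everywhere. -/
theorem exists_base {k : Type} [Field k] (W : PersMod k ℤ)
    (hfin : ∀ n, FiniteDimensional k (W.space n)) (t : ℤ) :
    ∃ (a : ℤ) (hat : a ≤ t), ∀ w : W.space a, ∃ x ∈ dX W ⊥, x t = W.map a t hat w := by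
  have hst : ∀ n : ℤ, ∃ a : ℤ, ∃ h : a ≤ n, ∀ m (hm : m ≤ n),
      LinearMap.range (W.map a n h) ≤ LinearMap.range (W.map m n hm) := by
    intro n
    have hmono : ∀ m m' (h : m ≤ n) (h' : m' ≤ n), m ≤ m' →
        LinearMap.range (W.map m n h) ≤ LinearMap.range (W.map m' n h') := by
      rintro m m' h h' hmm _ ⟨y, rfl⟩
      exact ⟨W.map m m' hmm y, W.map_map _ _ _⟩
    let f : ℕ →o (Submodule k (W.space n))ᵒᵈ :=
      ⟨fun i => OrderDual.toDual (LinearMap.range (W.map (n - i) n (by omega))), by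
        intro i j hij
        exact hmono _ _ _ _ (by omega)⟩
    obtain ⟨N, hN⟩ := IsArtinian.monotone_stabilizes f
    refine ⟨n - N, by omega, fun m hm => ?_⟩
    rcases le_total (n - (N : ℤ)) m with h | h
    · exact hmono _ _ _ _ h
    · have h1 := hN (n - m).toNat (by omega)
      have h2 : LinearMap.range (W.map (n - N) n (by omega))
        = LinearMap.range (W.map (n - ((n - m).toNat : ℤ)) n (by omega)) := h1
      rw [h2]
      exact hmono _ _ _ _ (by omega)
  choose a ha hst using hst
  let S : ∀ n, Submodule k (W.space n) := fun n => LinearMap.range (W.map (a n) n (ha n))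
  have hsurj : ∀ s t (h : s ≤ t) (w : W.space t), w ∈ S t → ∃ u ∈ S s, W.map s t h u = w := by
    intro s t h w hw
    obtain ⟨y, hy⟩ := hst t (a s) ((ha s).trans h) hw
    exact ⟨W.map (a s) s (ha s) y, ⟨y, rfl⟩, by rw [W.map_map, hy]⟩
  refine ⟨a t, ha t, fun w => ?_⟩
  let w0 : S t := ⟨W.map (a t) t (ha t) w, w, rfl⟩
  choose g hg1 hg2 using hsurj
  let seq : ∀ i : ℕ, S (t - (i : ℤ)) := fun i =>
    Nat.rec (motive := fun i => S (t - (i : ℤ)))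
      ⟨g (t - ((0 : ℕ) : ℤ)) t (by omega) w0.1 w0.2, hg1 _ _ _ _ _⟩
      (fun i y => ⟨g (t - ((i + 1 : ℕ) : ℤ)) (t - (i : ℤ)) (by omega) y.1 y.2, hg1 _ _ _ _ _⟩) i
  have hseq0 : W.map (t - ((0 : ℕ) : ℤ)) t (by omega) (seq 0).1 = w0.1 := hg2 _ _ _ _ _
  have hseqs : ∀ i : ℕ, W.map (t - ((i + 1 : ℕ) : ℤ)) (t - (i : ℤ)) (by omega) (seq (i + 1)).1
      = (seq i).1 := fun i => hg2 _ _ _ _ _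
  have hseq : ∀ i j : ℕ, i ≤ j → ∀ h : t - (j : ℤ) ≤ t - (i : ℤ),
      W.map (t - (j : ℤ)) (t - (i : ℤ)) h (seq j).1 = (seq i).1 := by
    intro i j hij
    induction j, hij using Nat.le_induction with
    | base => intro h; exact W.map_self _ _
    | succ j hij ih =>
      intro h
      rw [← ih (by omega), ← hseqs j, W.map_map]
  refine ⟨fun m => W.map (t - ((t - m).toNat : ℤ)) m (by omega) (seq (t - m).toNat).1, ?_, ?_⟩
  · intro m n h _
    show W.map m n h (W.map _ m _ _) = W.map _ n _ _
    rw [W.map_map, ← hseq (t - n).toNat (t - m).toNat (by omega) (by omega), W.map_map]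
  · show W.map _ t _ _ = w0.1
    rw [← hseq0, ← hseq 0 (t - t).toNat (by omega) (by omega), W.map_map]

theorem dX_step {k : Type} [Field k] (W : PersMod k ℤ) (t : ℤ) (β : WithBot ℤ)
    (C : WithTop ℤ → Submodule k (∀ n, W.space n))
    (hC : ∀ d, dN W β d ⊔ C d = dX W β ⊓ dZ W d)
    (T : Submodule k (∀ n, W.space n))
    (hT : ∀ x : ∀ n, W.space n, x t = 0 → x ∈ T)
    (hCT : ∀ d : WithTop ℤ, (t : WithTop ℤ) < d → C d ≤ T)
    (hlt : ∀ β' < β, dX W β' ≤ T) : dX W β ≤ T := by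
  have hlow : ∀ d : ℤ, d ≤ t → dX W β ⊓ dZ W d ≤ T := by
    intro d hd x hx
    exact hT x (hx.2 t (by exact_mod_cast hd))
  have hN : ∀ d : WithTop ℤ, (t : WithTop ℤ) < d → (∀ d' < d, dX W β ⊓ dZ W d' ≤ T) →
      dX W β ⊓ dZ W d ≤ T := by
    intro d hd h
    rw [← hC]
    exact sup_le (sup_le (inf_le_left.trans (iSup₂_le hlt)) (iSup₂_le h)) (hCT d hd)
  have hIntr : ∀ d : ℤ, dX W β ⊓ dZ W d ≤ T := by
    intro d
    rcases le_total d t with h | h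
    · exact hlow d h
    · induction d, h using Int.le_induction with
      | base => exact hlow t le_rfl
      | succ d hd ih =>
        apply hN _ (by exact_mod_cast Int.lt_add_one_iff.2 hd)
        intro d' hd'
        refine le_trans (inf_le_inf le_rfl (dZ_mono W ?_)) ih
        induction d' with
        | top => simp at hd'
        | coe e =>
          have : e < d + 1 := by exact_mod_cast hd'
          have : e ≤ d := by omega
          exact_mod_cast this
  have htop := hN ⊤ (WithTop.coe_lt_top t) (by
    intro d' hd'
    induction d' with
    | top => simp at hd'
    | coe e => exact hIntr e)
  intro x hx
  exact htop ⟨hx, fun n hn => absurd hn (by simp)⟩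

/-- Interval decomposition of pointwise finite-dimensional modules over `ℤ`. -/
theorem exists_decomp {k : Type} [Field k] (W : PersMod k ℤ)
    (hfin : ∀ n, FiniteDimensional k (W.space n)) :
    ∃ (L : Type) (E : L → Set ℤ) (hE : ∀ ℓ, (E ℓ).OrdConnected),
      (∀ ℓ, (E ℓ).Nonempty) ∧ PersIso W (barMod k E hE) := by
  have hex : ∀ β d, ∃ C : Submodule k (∀ n, W.space n), dN W β d ⊓ C = ⊥ ∧
      dN W β d ⊔ C = dX W β ⊓ dZ W d := fun β d => exists_rel_compl (dN_le W β d)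
  choose C hC1 hC2 using hex
  have hCle : ∀ β d, C β d ≤ dX W β ⊓ dZ W d := fun β d => by
    rw [← hC2]; exact le_sup_right
  let O : Type := {o : WithBot ℤ × WithTop ℤ // ∃ n : ℤ, o.1 ≤ n ∧ n < o.2}
  let bas := fun o : O => Module.Basis.ofVectorSpace k (C o.1.1 o.1.2)
  let L : Type := Σ o : O, Module.Basis.ofVectorSpaceIndex k (C o.1.1 o.1.2)
  let x : L → ∀ n, W.space n := fun ℓ => (bas ℓ.1 ℓ.2).1
  let E : L → Set ℤ := fun ℓ => {n | ℓ.1.1.1 ≤ (n : WithBot ℤ) ∧ (n : WithTop ℤ) < ℓ.1.1.2}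
  have hE : ∀ ℓ, (E ℓ).OrdConnected := fun ℓ => ⟨fun a ha b hb c hc =>
    ⟨ha.1.trans (by exact_mod_cast hc.1), lt_of_le_of_lt (by exact_mod_cast hc.2) hb.2⟩⟩
  have hxC : ∀ ℓ, x ℓ ∈ C ℓ.1.1.1 ℓ.1.1.2 := fun ℓ => (bas ℓ.1 ℓ.2).2
  have hxX : ∀ ℓ, x ℓ ∈ dX W ℓ.1.1.1 := fun ℓ => (hCle _ _ (hxC ℓ)).1
  have hxZ : ∀ ℓ, x ℓ ∈ dZ W ℓ.1.1.2 := fun ℓ => (hCle _ _ (hxC ℓ)).2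
  refine ⟨L, E, hE, fun ℓ => ℓ.1.2, PersIso.symm' ?_⟩
  let F : ∀ t : ℤ, barSp k E t →ₗ[k] W.space t := fun t =>
    LinearMap.proj t ∘ₗ Finsupp.linearCombination k x ∘ₗ (barSp k E t).subtype
  have hF : ∀ t f, F t f = ∑ ℓ ∈ f.1.support, f.1 ℓ • x ℓ t := by
    intro t f
    show (Finsupp.linearCombination k x f.1) t = _
    rw [Finsupp.linearCombination_apply, Finsupp.sum, Finset.sum_apply]
    rfl
  have hinj : ∀ t, Function.Injective (F t) := by
    intro t
    refine inj_of_ker (barSp k E t) (F t) ?_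
    intro f hf
    by_contra hne
    have hsup : f.1.support.Nonempty := by
      rw [Finset.nonempty_iff_ne_empty]
      intro h
      exact hne (Subtype.ext (Finsupp.support_eq_empty.1 h))
    obtain ⟨ℓ0, hℓ0, hmax⟩ := Finset.exists_max_image f.1.support
      (fun ℓ => toLex (ℓ.1.1.1, ℓ.1.1.2)) hsup
    have hmem : ∀ ℓ ∈ f.1.support, t ∈ E ℓ := by
      intro ℓ hℓ
      by_contra h
      exact (Finsupp.mem_support_iff.1 hℓ) (f.2 ℓ h)
    obtain ⟨⟨⟨β, d⟩, ho⟩, j0⟩ := ℓ0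
    let o : O := ⟨(β, d), ho⟩
    have htE := hmem _ hℓ0
    have htd : (t : WithTop ℤ) < d := htE.2
    have hβt : β ≤ (t : WithBot ℤ) := htE.1
    have hle : ∀ ℓ ∈ f.1.support, ℓ.1.1.1 < β ∨ (ℓ.1.1.1 = β ∧ ℓ.1.1.2 ≤ d) := by
      intro ℓ hℓ
      have := hmax ℓ hℓ
      rw [Prod.Lex.toLex_le_toLex] at this
      exact this
    set S := f.1.support with hS
    set u1 : ∀ n, W.space n := ∑ ℓ ∈ S.filter (fun ℓ => ℓ.1 = o), f.1 ℓ • x ℓ with hu1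
    set v : ∀ n, W.space n := ∑ ℓ ∈ S.filter (fun ℓ => ¬ ℓ.1 = o), f.1 ℓ • x ℓ with hv
    set u2 : ∀ n, W.space n :=
      ∑ ℓ ∈ (S.filter (fun ℓ => ¬ ℓ.1 = o)).filter (fun ℓ => ℓ.1.1.1 = β), f.1 ℓ • x ℓ with hu2
    set u3 : ∀ n, W.space n :=
      ∑ ℓ ∈ (S.filter (fun ℓ => ¬ ℓ.1 = o)).filter (fun ℓ => ¬ ℓ.1.1.1 = β), f.1 ℓ • x ℓ with hu3
    have hv' : u2 + u3 = v := Finset.sum_filter_add_sum_filter_not _ _ _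
    set z : ∀ n, W.space n := ∑ ℓ ∈ S, f.1 ℓ • x ℓ with hz
    have hz' : u1 + v = z := Finset.sum_filter_add_sum_filter_not _ _ _
    have hu1C : u1 ∈ C β d := by
      refine Submodule.sum_mem _ fun ℓ hℓ => Submodule.smul_mem _ _ ?_
      have h := hxC ℓ
      rw [(Finset.mem_filter.1 hℓ).2] at h
      exact h
    have hu2N : u2 ∈ ⨆ d' < d, (dX W β ⊓ dZ W d') := by
      refine Submodule.sum_mem _ fun ℓ hℓ => Submodule.smul_mem _ _ ?_
      rw [Finset.mem_filter, Finset.mem_filter] at hℓ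
      obtain ⟨⟨h1, h2⟩, h3⟩ := hℓ
      have h4 : ℓ.1.1.2 ≤ d := by
        rcases hle ℓ h1 with h | h
        · exact absurd h3 h.ne
        · exact h.2
      have h5 : ℓ.1.1.2 < d := by
        refine lt_of_le_of_ne h4 fun h => h2 (Subtype.ext (Prod.ext h3 h))
      have h6 : dX W β ⊓ dZ W ℓ.1.1.2 ≤ ⨆ d' < d, (dX W β ⊓ dZ W d') :=
        le_iSup₂_of_le ℓ.1.1.2 h5 le_rfl
      exact h6 ⟨h3 ▸ hxX ℓ, hxZ ℓ⟩
    have hu3X : u3 ∈ ⨆ β' < β, dX W β' := by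
      refine Submodule.sum_mem _ fun ℓ hℓ => Submodule.smul_mem _ _ ?_
      rw [Finset.mem_filter, Finset.mem_filter] at hℓ
      obtain ⟨⟨h1, h2⟩, h3⟩ := hℓ
      have h4 : ℓ.1.1.1 < β := by
        rcases hle ℓ h1 with h | h
        · exact h
        · exact absurd h.1 h3
      have h6 : dX W ℓ.1.1.1 ≤ ⨆ β' < β, dX W β' := le_iSup₂_of_le ℓ.1.1.1 h4 le_rfl
      exact h6 (hxX ℓ)
    have hu1' := hCle _ _ hu1C
    have hu2' := iSup_dXZ_le W β d hu2N
    have hu3' := iSup_dX_le W β hu3X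
    have hzt : z t = 0 := by
      rw [hF] at hf
      rw [hz, Finset.sum_apply]
      exact hf
    have hzX : z ∈ dX W β := by
      rw [← hz', ← hv']
      exact add_mem hu1'.1 (add_mem hu2'.1 hu3')
    have hzZ : z ∈ dZ W (t : WithTop ℤ) := by
      intro n hn
      have hn' : t ≤ n := by exact_mod_cast hn
      rw [← hzX t n hn' hβt, hzt, map_zero]
    have hzN : z ∈ ⨆ d' < d, (dX W β ⊓ dZ W d') := by
      have h6 : dX W β ⊓ dZ W (t : WithTop ℤ) ≤ ⨆ d' < d, (dX W β ⊓ dZ W d') :=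
        le_iSup₂_of_le (t : WithTop ℤ) htd le_rfl
      exact h6 ⟨hzX, hzZ⟩
    have hu3eq : u3 = z - u1 - u2 := by rw [← hz', ← hv']; abel
    have hu1eq : u1 = (z - u2) - u3 := by rw [← hz', ← hv']; abel
    have hu3Z : u3 ∈ dZ W d := by
      rw [hu3eq]
      exact sub_mem (sub_mem (dZ_mono W htd.le hzZ) hu1'.2) hu2'.2
    have hu1N : u1 ∈ dN W β d := by
      rw [hu1eq]
      exact sub_mem (Submodule.mem_sup_right (sub_mem hzN hu2N))
        (Submodule.mem_sup_left ⟨hu3X, hu3Z⟩)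
    have hu10 : u1 = 0 := by
      have : u1 ∈ dN W β d ⊓ C β d := ⟨hu1N, hu1C⟩
      rw [hC1] at this
      exact this
    have hli : LinearIndependent k (fun j => (bas o j).1) :=
      (bas o).linearIndependent.map' (C β d).subtype (Submodule.ker_subtype _)
    have hinjs : Function.Injective (fun j => (⟨o, j⟩ : L)) := by
      intro a b hab
      simpa using hab
    have hsum : ∑ j ∈ S.preimage (fun j => (⟨o, j⟩ : L)) hinjs.injOn,
        f.1 ⟨o, j⟩ • (bas o j).1 = 0 := by
      rw [← hu10, hu1, Finset.sum_filter]
      rw [← Finset.sum_preimage (fun j => (⟨o, j⟩ : L)) S hinjs.injOn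
        (fun ℓ => if ℓ.1 = o then f.1 ℓ • x ℓ else 0)]
      · exact Finset.sum_congr rfl fun j _ => (if_pos rfl).symm
      · intro ℓ _ hℓ
        rw [if_neg]
        intro h
        apply hℓ
        obtain ⟨o', j⟩ := ℓ
        subst h
        exact ⟨j, rfl⟩
    have := linearIndependent_iff'.1 hli _ _ hsum j0 (by
      rw [Finset.mem_preimage]; exact hℓ0)
    exact (Finsupp.mem_support_iff.1 hℓ0) this
  have hsurj : ∀ t, Function.Surjective (F t) := by
    intro t
    set Sp : Submodule k (∀ n, W.space n) := Submodule.span k (x '' {ℓ | t ∈ E ℓ}) with hSp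
    set T := Sp ⊔ LinearMap.ker (LinearMap.proj t : (∀ n, W.space n) →ₗ[k] W.space t) with hTdef
    have hT : ∀ y : ∀ n, W.space n, y t = 0 → y ∈ T := fun y hy => Submodule.mem_sup_right hy
    have hCT : ∀ (β : WithBot ℤ) (hβ : β ≤ (t : WithBot ℤ)) (d : WithTop ℤ),
        (t : WithTop ℤ) < d → C β d ≤ T := by
      intro β hβ d hd
      refine le_trans ?_ le_sup_left
      let o : O := ⟨(β, d), t, hβ, hd⟩
      intro y hy
      have h1 : (⟨y, hy⟩ : C β d) ∈ Submodule.span k (Set.range (bas o)) := by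
        rw [(bas o).span_eq]; trivial
      have h2 := Submodule.mem_map_of_mem (f := (C β d).subtype) h1
      rw [Submodule.map_span] at h2
      refine Submodule.span_mono ?_ h2
      rintro _ ⟨_, ⟨j, rfl⟩, rfl⟩
      exact ⟨⟨o, j⟩, ⟨hβ, hd⟩, rfl⟩
    have hbot : dX W ⊥ ≤ T :=
      dX_step W t ⊥ (C ⊥) (hC2 ⊥) T hT (hCT ⊥ bot_le) (fun β' h => absurd h (by simp))
    obtain ⟨a, hat, ha⟩ := exists_base W hfin t
    have haT : dX W (a : WithBot ℤ) ≤ T := by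
      intro y hy
      obtain ⟨x', hx', hx't⟩ := ha (y a)
      have : y = x' + (y - x') := by abel
      rw [this]
      refine add_mem (hbot hx') (hT _ ?_)
      rw [Pi.sub_apply, hx't, hy a t hat le_rfl, sub_self]
    have hall : ∀ b : ℤ, a ≤ b → b ≤ t → dX W (b : WithBot ℤ) ≤ T := by
      intro b hab
      induction b, hab using Int.le_induction with
      | base => intro _; exact haT
      | succ b hab ih =>
        intro hbt
        refine dX_step W t _ (C _) (hC2 _) T hT (hCT _ (by exact_mod_cast hbt)) ?_
        intro β' hβ'
        refine le_trans (dX_mono W ?_) (ih (by omega))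
        induction β' with
        | bot => exact bot_le
        | coe e =>
          have : e < b + 1 := by exact_mod_cast hβ'
          have : e ≤ b := by omega
          exact_mod_cast this
    intro w
    let y : ∀ n, W.space n := fun n => if h : t ≤ n then W.map t n h w else 0
    have hy : y ∈ dX W (t : WithBot ℤ) := by
      intro m n hmn hm
      have hm' : t ≤ m := by exact_mod_cast hm
      show W.map m n hmn (if h : t ≤ m then W.map t m h w else 0) =
        if h : t ≤ n then W.map t n h w else 0
      rw [dif_pos hm', dif_pos (hm'.trans hmn), W.map_map]
    have hyT := hall t hat le_rfl hy
    obtain ⟨s, hs, r, hr, hsr⟩ := Submodule.mem_sup.1 hyT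
    obtain ⟨f, hf, hfs⟩ := (Finsupp.mem_span_image_iff_linearCombination k).1 hs
    refine ⟨⟨f, fun ℓ hℓ => ?_⟩, ?_⟩
    · by_contra h
      exact hℓ (hf (Finsupp.mem_support_iff.2 h))
    · show (Finsupp.linearCombination k x f) t = w
      have h1 : y t = w := by
        show (if h : t ≤ t then W.map t t h w else 0) = w
        rw [dif_pos le_rfl, W.map_self]
      have h2 : r t = 0 := hr
      rw [hfs, ← h1, ← hsr, Pi.add_apply, h2, add_zero]
  refine ⟨fun t => LinearEquiv.ofBijective (F t) ⟨hinj t, hsurj t⟩, fun s t h => ?_⟩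
  refine LinearMap.ext fun f => ?_
  show F t (barProj k E t f.1) = W.map s t h (F s f)
  show (Finsupp.linearCombination k x (barProj k E t f.1).1) t
    = W.map s t h ((Finsupp.linearCombination k x f.1) s)
  rw [Finsupp.linearCombination_apply, Finsupp.linearCombination_apply,
    Finsupp.sum_of_support_subset (s := f.1.support), Finsupp.sum]
  · rw [Finset.sum_apply, Finset.sum_apply, map_sum]
    refine Finset.sum_congr rfl fun ℓ hℓ => ?_
    have hsE : s ∈ E ℓ := by
      by_contra h
      exact (Finsupp.mem_support_iff.1 hℓ) (f.2 ℓ h)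
    rw [barProj_apply, Pi.smul_apply, Pi.smul_apply, map_smul, hxX ℓ s t h hsE.1]
    split_ifs with ht
    · rfl
    · have : x ℓ t = 0 := by
        apply hxZ ℓ t
        by_contra hlt
        exact ht ⟨hsE.1.trans (by exact_mod_cast h), not_le.1 hlt⟩
      rw [this]
      simp
  · intro ℓ hℓ
    rw [Finsupp.mem_support_iff] at hℓ ⊢
    rw [barProj_apply] at hℓ
    intro h
    exact hℓ (by simp [h])
  · intro i _
    simp

end Decomp

section Ranks

theorem edim_congr {k M N : Type} [Field k] [AddCommGroup M] [Module k M] [AddCommGroup N]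
    [Module k N] (e : M ≃ₗ[k] N) : edim k M = edim k N := by
  unfold edim
  rw [e.rank_eq]

theorem edim_map_subtype {k M : Type} [Field k] [AddCommGroup M] [Module k M]
    (S : Submodule k M) (R : Submodule k S) : edim k R = edim k (R.map S.subtype) :=
  edim_congr (Submodule.equivMapOfInjective S.subtype S.injective_subtype R)

theorem erank_toSub {k M N : Type} [Field k] [AddCommGroup M] [Module k M] [AddCommGroup N]
    [Module k N] (S : Submodule k N) (f : M →ₗ[k] S) :
    erank f = edim k (LinearMap.range (S.subtype ∘ₗ f)) := by
  unfold erank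
  rw [edim_map_subtype, ← LinearMap.range_comp]

theorem edim_supported (k : Type) [Field k] {L : Type} (s : Set L) :
    edim k (Finsupp.supported k k s) = s.encard := by
  rw [edim_congr (Finsupp.supportedEquivFinsupp s)]
  unfold edim
  rw [rank_finsupp_self, Cardinal.lift_id]
  rfl

theorem erank_barProj {k : Type} [Field k] {T L : Type} (J : L → Set T) (s t : T) :
    erank (M := barSp k J s) (N := barSp k J t)
      (barProj k J t ∘ₗ (barSp k J s).subtype) = {ℓ | s ∈ J ℓ ∧ t ∈ J ℓ}.encard := by
  rw [← edim_supported k, erank_toSub]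
  have : LinearMap.range ((barSp k J t).subtype ∘ₗ barProj k J t ∘ₗ (barSp k J s).subtype) =
      Finsupp.supported k k {ℓ | s ∈ J ℓ ∧ t ∈ J ℓ} := by
    ext f
    rw [Finsupp.mem_supported]
    constructor
    · rintro ⟨g, rfl⟩ ℓ hℓ
      have h1 : (barProj k J t g.1).1 ℓ ≠ 0 := Finsupp.mem_support_iff.1 hℓ
      rw [barProj_apply] at h1
      refine ⟨?_, ?_⟩
      · by_contra h2
        rw [g.2 ℓ h2] at h1
        simp at h1
      · by_contra h2
        rw [if_neg h2] at h1
        exact h1 rfl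
    · intro hf
      have hf' : ∀ ℓ, f ℓ ≠ 0 → s ∈ J ℓ ∧ t ∈ J ℓ := fun ℓ hℓ => hf (Finsupp.mem_support_iff.2 hℓ)
      refine ⟨⟨f, fun ℓ hℓ => ?_⟩, ?_⟩
      · by_contra h1
        exact hℓ (hf' ℓ h1).1
      · refine Finsupp.ext fun ℓ => ?_
        show (barProj k J t f).1 ℓ = f ℓ
        rw [barProj_apply]
        split_ifs with h1
        · rfl
        · by_contra h2
          exact h1 (hf' ℓ (Ne.symm h2)).2
  rw [this]

theorem erank_barMod {k : Type} [Field k] {T L : Type} [Preorder T] (J : L → Set T)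
    (hJ : ∀ ℓ, (J ℓ).OrdConnected) {s t : T} (h : s ≤ t) :
    erank ((barMod k J hJ).map s t h) = {ℓ | s ∈ J ℓ ∧ t ∈ J ℓ}.encard :=
  erank_barProj J s t

theorem erank_iso {k : Type} [Field k] {T : Type} [Preorder T] {U V : PersMod k T}
    (h : PersIso U V) {s t : T} (hst : s ≤ t) : erank (U.map s t hst) = erank (V.map s t hst) := by
  obtain ⟨e, he⟩ := h
  have : LinearMap.range (V.map s t hst)
      = (LinearMap.range (U.map s t hst)).map (e t).toLinearMap := by
    rw [← LinearMap.range_comp, he, LinearMap.range_comp, LinearEquiv.range, Submodule.map_top]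
  unfold erank
  rw [this]
  exact edim_congr ((e t).submoduleMap _)

theorem erank_smoothing {k : Type} [Field k] (V : PersMod k ℝ) (ε : ℝ) (hε : 0 < ε) {s t : ℝ}
    (h : s ≤ t) (h' : s - ε ≤ t + ε) :
    erank ((smoothing V ε hε).map s t h) = erank (V.map (s - ε) (t + ε) h') := by
  refine (erank_toSub (LinearMap.range (V.map (t - ε) (t + ε) (by linarith)))
    ((smoothing V ε hε).map s t h)).trans ?_
  have : LinearMap.range ((LinearMap.range (V.map (t - ε) (t + ε) (by linarith))).subtype ∘ₗ
      ((smoothing V ε hε).map s t h)) = LinearMap.range (V.map (s - ε) (t + ε) h') := by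
    ext y
    constructor
    · rintro ⟨⟨_, ⟨x, rfl⟩⟩, rfl⟩
      exact ⟨x, (V.map_map _ _ x).symm⟩
    · rintro ⟨x, rfl⟩
      exact ⟨⟨_, ⟨x, rfl⟩⟩, V.map_map _ _ x⟩
  exact congrArg (fun R : Submodule k (V.space (t + ε)) => edim k R) this

theorem edim_lt_top {k M : Type} [Field k] [AddCommGroup M] [Module k M] (h : edim k M ≠ ⊤) :
    FiniteDimensional k M := by
  unfold edim at h
  rw [Ne, Cardinal.toENat_eq_top, not_le] at h
  exact Module.rank_lt_aleph0_iff.1 h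

theorem decMem_convex (x : (EReal × Bool) × (EReal × Bool)) :
    {t : ℝ | decMem t x}.OrdConnected := by
  refine ⟨fun a ha b hb c hc => ⟨?_, ?_⟩⟩
  · have hac : (a : EReal) ≤ c := by exact_mod_cast hc.1
    rcases ha.1 with h | h
    · exact Or.inl (h.trans_le hac)
    · rcases hac.lt_or_eq with h1 | h1
      · exact Or.inl (h.1 ▸ h1)
      · exact Or.inr (h1 ▸ h)
  · have hcb : (c : EReal) ≤ b := by exact_mod_cast hc.2
    rcases hb.2 with h | h
    · exact Or.inl (hcb.trans_lt h)
    · rcases hcb.lt_or_eq with h1 | h1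
      · exact Or.inl (h.1 ▸ h1)
      · exact Or.inr (h1 ▸ h)

theorem persIm_coe {k : Type} [Field k] (V : PersMod k ℝ) {s t : ℝ} (h : s ≤ t) :
    persIm V (s : EReal) t = LinearMap.range (V.map s t h) := by
  have hex : ∃ a' : ℝ, (s : EReal) = (a' : EReal) ∧ a' ≤ t := ⟨s, rfl, h⟩
  unfold persIm
  rw [dif_pos hex]
  have h1 : hex.choose = s := (EReal.coe_injective hex.choose_spec.1).symm
  have : ∀ a (ha : a ≤ t), a = s → LinearMap.range (V.map a t ha) = LinearMap.range (V.map s t h) := by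
    rintro a ha rfl
    rfl
  exact this _ _ h1

theorem erank_dgm {k : Type} [Field k] {V : PersMod k ℝ} {ι : Type}
    {D : ι → (EReal × Bool) × (EReal × Bool)} (hD : IsDgmOf V D) {s t : ℝ} (h : s ≤ t) :
    erank (V.map s t h) = {i | decMem s (D i) ∧ decMem t (D i)}.encard := by
  have h1 := hD.2 ⊥ s t ⊤ (EReal.bot_lt_coe s) h (EReal.coe_lt_top t)
  have h2 : persMeasure V ⊥ s t ⊤ = erank (V.map s t h) := by
    unfold persMeasure
    have hk : persKer V t ⊤ = ⊤ := by
      unfold persKer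
      rw [dif_neg]
      rintro ⟨d, hd, _⟩
      exact EReal.coe_ne_top d hd.symm
    have hb : persIm V ⊥ t = ⊥ := by
      unfold persIm
      rw [dif_neg]
      rintro ⟨d, hd, _⟩
      exact EReal.coe_ne_bot d hd.symm
    rw [hk, hb, persIm_coe V h, inf_top_eq, inf_top_eq]
    refine edim_congr ?_
    refine Submodule.quotEquivOfEqBot _ ?_
    rw [Submodule.comap_bot, Submodule.ker_subtype]
  rw [← h2, h1]
  show Set.encard {i | decInRect (D i) ⊥ s t ⊤} = _
  congr 1
  ext i
  constructor
  · intro hi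
    exact ⟨hi.1 s ⟨le_rfl, h⟩, hi.1 t ⟨h, le_rfl⟩⟩
  · rintro ⟨hs, ht⟩
    exact ⟨fun u hu => (decMem_convex (D i)).out hs ht hu,
      fun u _ => ⟨EReal.bot_lt_coe u, EReal.coe_lt_top u⟩⟩

end Ranks

section Counting

theorem count_sub {L I : Type} (E : L → Set ℤ) (G : I → Set ℤ)
    (hE : ∀ ℓ, (E ℓ).OrdConnected) (hG : ∀ i, (G i).OrdConnected)
    (hfin : ∀ n, {ℓ | n ∈ E ℓ}.Finite) (hfin' : ∀ n, {i | n ∈ G i}.Finite)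
    (hcount : ∀ m n : ℤ, m ≤ n →
      {ℓ | m ∈ E ℓ ∧ n ∈ E ℓ}.ncard = {i | m ∈ G i ∧ n ∈ G i}.ncard)
    (X : Set ℤ) (hX : X.OrdConnected) (hX0 : X.Nonempty) :
    {ℓ | X ⊆ E ℓ}.ncard = {i | X ⊆ G i}.ncard := by
  obtain ⟨x0, hx0⟩ := hX0
  have h1 : ∀ Y : Set ℤ, ∃ x ∈ X, ¬ X ⊆ Y → x ∉ Y := by
    intro Y
    by_cases h : X ⊆ Y
    · exact ⟨x0, hx0, fun h' => absurd h h'⟩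
    · obtain ⟨x, hx, hx'⟩ := Set.not_subset.1 h
      exact ⟨x, hx, fun _ => hx'⟩
  choose g hgX hg using h1
  let P : Finset ℤ := insert x0 (((hfin x0).toFinset.image fun ℓ => g (E ℓ)) ∪
    ((hfin' x0).toFinset.image fun i => g (G i)))
  have hPne : P.Nonempty := ⟨x0, Finset.mem_insert_self _ _⟩
  have hPX : ∀ x ∈ P, x ∈ X := by
    intro x hx
    rcases Finset.mem_insert.1 hx with rfl | hx
    · exact hx0
    · rcases Finset.mem_union.1 hx with hx | hx
      · obtain ⟨ℓ, _, rfl⟩ := Finset.mem_image.1 hx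
        exact hgX _
      · obtain ⟨ℓ, _, rfl⟩ := Finset.mem_image.1 hx
        exact hgX _
  have hsub : ∀ Y : Set ℤ, Y.OrdConnected → (x0 ∈ Y → g Y ∈ P) →
      (X ⊆ Y ↔ P.min' hPne ∈ Y ∧ P.max' hPne ∈ Y) := by
    intro Y hY hgP
    constructor
    · intro h
      exact ⟨h (hPX _ (P.min'_mem hPne)), h (hPX _ (P.max'_mem hPne))⟩
    · rintro ⟨ha, hb⟩
      have hPY : ∀ x ∈ P, x ∈ Y := fun x hx => hY.out ha hb ⟨P.min'_le x hx, P.le_max' x hx⟩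
      by_contra h
      exact hg Y h (hPY _ (hgP (hPY x0 (Finset.mem_insert_self _ _))))
  have e1 : {ℓ | X ⊆ E ℓ} = {ℓ | P.min' hPne ∈ E ℓ ∧ P.max' hPne ∈ E ℓ} := by
    ext ℓ
    refine hsub _ (hE ℓ) fun h => ?_
    exact Finset.mem_insert_of_mem (Finset.mem_union_left _ (Finset.mem_image.2
      ⟨ℓ, (hfin x0).mem_toFinset.2 h, rfl⟩))
  have e2 : {i | X ⊆ G i} = {i | P.min' hPne ∈ G i ∧ P.max' hPne ∈ G i} := by
    ext ℓ
    refine hsub _ (hG ℓ) fun h => ?_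
    exact Finset.mem_insert_of_mem (Finset.mem_union_right _ (Finset.mem_image.2
      ⟨ℓ, (hfin' x0).mem_toFinset.2 h, rfl⟩))
  rw [e1, e2]
  exact hcount _ _ (P.min'_le _ (P.max'_mem hPne))

theorem ncard_split {L : Type} (E : L → Set ℤ) (hfin : ∀ n, {ℓ | n ∈ E ℓ}.Finite)
    (X : Set ℤ) (hX0 : X.Nonempty) (K : Finset (Set ℤ)) (hK : ∀ Y ∈ K, X ⊂ Y)
    (hK' : ∀ ℓ, X ⊂ E ℓ → E ℓ ∈ K) :
    {ℓ | X ⊆ E ℓ}.ncard = {ℓ | E ℓ = X}.ncard + ∑ Y ∈ K, {ℓ | E ℓ = Y}.ncard := by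
  obtain ⟨x0, hx0⟩ := hX0
  have hf1 : {ℓ | X ⊆ E ℓ}.Finite := (hfin x0).subset fun ℓ h => h hx0
  have hf2 : {ℓ | E ℓ = X}.Finite := hf1.subset fun ℓ h => (Eq.symm h).subset
  have hf3 : {ℓ | X ⊂ E ℓ}.Finite := hf1.subset fun ℓ h => h.1
  have h1 : {ℓ | X ⊆ E ℓ} = {ℓ | E ℓ = X} ∪ {ℓ | X ⊂ E ℓ} := by
    ext ℓ
    show X ⊆ E ℓ ↔ E ℓ = X ∨ X ⊂ E ℓ
    constructor
    · intro h
      by_cases h' : E ℓ = X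
      · exact Or.inl h'
      · exact Or.inr (h.ssubset_of_ne (Ne.symm h'))
    · rintro (h | h)
      · exact (Eq.symm h).subset
      · exact h.1
  rw [h1, Set.ncard_union_eq ?_ hf2 hf3]
  · congr 1
    rw [Set.ncard_eq_toFinset_card _ hf3, Finset.card_eq_sum_card_fiberwise (f := E) (t := K)]
    · refine Finset.sum_congr rfl fun Y hY => ?_
      rw [← Set.ncard_coe_finset]
      congr 1
      ext ℓ
      simp only [Finset.coe_filter, Set.Finite.mem_toFinset, Set.mem_setOf_eq]
      constructor
      · exact fun h => h.2
      · exact fun h => ⟨h ▸ hK Y hY, h⟩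
    · intro ℓ hℓ
      exact hK' ℓ (by simpa using hℓ)
  · rw [Set.disjoint_left]
    intro ℓ h h'
    exact h'.ne (Eq.symm h)

theorem count_eq {L I : Type} (E : L → Set ℤ) (G : I → Set ℤ)
    (hE : ∀ ℓ, (E ℓ).OrdConnected) (hG : ∀ i, (G i).OrdConnected)
    (hfin : ∀ n, {ℓ | n ∈ E ℓ}.Finite) (hfin' : ∀ n, {i | n ∈ G i}.Finite)
    (hcount : ∀ m n : ℤ, m ≤ n →
      {ℓ | m ∈ E ℓ ∧ n ∈ E ℓ}.ncard = {i | m ∈ G i ∧ n ∈ G i}.ncard)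
    (N : ℕ) : ∀ (X : Set ℤ) (hX : X.OrdConnected) (hX0 : X.Nonempty)
    (hN : {Y | X ⊂ Y ∧ (Y ∈ Set.range E ∨ Y ∈ Set.range G)}.ncard ≤ N),
    {ℓ | E ℓ = X}.ncard = {i | G i = X}.ncard := by
  have hKfin : ∀ X : Set ℤ, X.Nonempty →
      {Y | X ⊂ Y ∧ (Y ∈ Set.range E ∨ Y ∈ Set.range G)}.Finite := by
    rintro X ⟨x0, hx0⟩
    refine (((hfin x0).image E).union ((hfin' x0).image G)).subset ?_
    rintro Y ⟨hY, ⟨ℓ, rfl⟩ | ⟨ℓ, rfl⟩⟩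
    · exact Or.inl ⟨ℓ, hY.1 hx0, rfl⟩
    · exact Or.inr ⟨ℓ, hY.1 hx0, rfl⟩
  induction N with
  | zero =>
    intro X hX hX0 hN
    have h0 : {Y | X ⊂ Y ∧ (Y ∈ Set.range E ∨ Y ∈ Set.range G)} = ∅ :=
      (Set.ncard_eq_zero (hKfin X hX0)).1 (Nat.le_zero.1 hN)
    have h := count_sub E G hE hG hfin hfin' hcount X hX hX0
    rw [ncard_split E hfin X hX0 ∅ (by simp) ?_, ncard_split G hfin' X hX0 ∅ (by simp) ?_] at h
    · simpa using h
    · intro ℓ hℓ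
      exact absurd (h0.subset (show G ℓ ∈ {Y | X ⊂ Y ∧ (Y ∈ Set.range E ∨ Y ∈ Set.range G)} from
        ⟨hℓ, Or.inr ⟨ℓ, rfl⟩⟩)) (Set.notMem_empty _)
    · intro ℓ hℓ
      exact absurd (h0.subset (show E ℓ ∈ {Y | X ⊂ Y ∧ (Y ∈ Set.range E ∨ Y ∈ Set.range G)} from
        ⟨hℓ, Or.inl ⟨ℓ, rfl⟩⟩)) (Set.notMem_empty _)
  | succ N ih =>
    intro X hX hX0 hN
    have h := count_sub E G hE hG hfin hfin' hcount X hX hX0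
    rw [ncard_split E hfin X hX0 (hKfin X hX0).toFinset (by simp +contextual) ?_,
      ncard_split G hfin' X hX0 (hKfin X hX0).toFinset (by simp +contextual) ?_] at h
    · have hs : ∑ Y ∈ (hKfin X hX0).toFinset, {ℓ | E ℓ = Y}.ncard
          = ∑ Y ∈ (hKfin X hX0).toFinset, {i | G i = Y}.ncard := by
        refine Finset.sum_congr rfl fun Y hY => ?_
        have hY' := (hKfin X hX0).mem_toFinset.1 hY
        refine ih Y ?_ (hX0.mono hY'.1.1) ?_
        · rcases hY'.2 with ⟨ℓ, rfl⟩ | ⟨ℓ, rfl⟩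
          · exact hE ℓ
          · exact hG ℓ
        · have : {Y' | Y ⊂ Y' ∧ (Y' ∈ Set.range E ∨ Y' ∈ Set.range G)}.ncard <
              {Y | X ⊂ Y ∧ (Y ∈ Set.range E ∨ Y ∈ Set.range G)}.ncard := by
            refine Set.ncard_lt_ncard ?_ (hKfin X hX0)
            refine (Set.ssubset_iff_of_subset ?_).2 ⟨Y, hY', fun h => h.1.ne rfl⟩
            rintro Z ⟨h1, h2⟩
            exact ⟨hY'.1.trans h1, h2⟩
          omega
      omega
    · intro ℓ hℓ
      exact (Set.Finite.mem_toFinset _).2 ⟨hℓ, Or.inr ⟨ℓ, rfl⟩⟩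
    · intro ℓ hℓ
      exact (Set.Finite.mem_toFinset _).2 ⟨hℓ, Or.inl ⟨ℓ, rfl⟩⟩

theorem exists_bar_matching {L I : Type} (E : L → Set ℤ) (G : I → Set ℤ)
    (hE : ∀ ℓ, (E ℓ).OrdConnected) (hG : ∀ i, (G i).OrdConnected)
    (hE0 : ∀ ℓ, (E ℓ).Nonempty)
    (hcount : ∀ m n : ℤ, m ≤ n →
      {ℓ | m ∈ E ℓ ∧ n ∈ E ℓ}.encard = {i | m ∈ G i ∧ n ∈ G i}.encard)
    (hfin : ∀ n, {ℓ | n ∈ E ℓ}.Finite) :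
    ∃ M : Set (L × I), IsMatching M ∧ (∀ p ∈ M, E p.1 = G p.2) ∧
      (∀ ℓ, ∃ i, (ℓ, i) ∈ M) ∧ (∀ i, (G i).Nonempty → ∃ ℓ, (ℓ, i) ∈ M) := by
  have hfin' : ∀ n, {i | n ∈ G i}.Finite := by
    intro n
    have h := hcount n n le_rfl
    simp only [and_self] at h
    rw [← Set.encard_lt_top_iff, ← h, Set.encard_lt_top_iff]
    exact hfin n
  have hc : ∀ X : Set ℤ, X.OrdConnected → X.Nonempty →
      {ℓ | E ℓ = X}.ncard = {i | G i = X}.ncard := fun X hX hX0 =>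
    count_eq E G hE hG hfin hfin' (fun m n h => congrArg ENat.toNat (hcount m n h)) _ X hX hX0 le_rfl
  have hb : ∀ X : Set ℤ, ∃ M : Set (L × I), X.OrdConnected → X.Nonempty →
      (IsMatching M ∧ (∀ p ∈ M, E p.1 = X ∧ G p.2 = X) ∧
      (∀ ℓ, E ℓ = X → ∃ i, (ℓ, i) ∈ M) ∧ (∀ i, G i = X → ∃ ℓ, (ℓ, i) ∈ M)) := by
    intro X
    by_cases hX : X.OrdConnected
    swap
    · exact ⟨∅, fun h => absurd h hX⟩
    by_cases hX0 : X.Nonempty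
    swap
    · exact ⟨∅, fun _ h => absurd h hX0⟩
    have hx0 := hX0.some_mem
    have f1 : {ℓ | E ℓ = X}.Finite := (hfin hX0.some).subset fun ℓ h => (Eq.symm h).subset hx0
    have f2 : {i | G i = X}.Finite := (hfin' hX0.some).subset fun ℓ h => (Eq.symm h).subset hx0
    have : Finite {ℓ | E ℓ = X} := f1
    have : Finite {i | G i = X} := f2
    have hcard : Nat.card {ℓ | E ℓ = X} = Nat.card {i | G i = X} := hc X hX hX0
    let e : {ℓ | E ℓ = X} ≃ {i | G i = X} :=
      (Finite.card_eq.1 hcard).some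
    refine ⟨{p | ∃ h : E p.1 = X, (e ⟨p.1, h⟩).1 = p.2}, fun _ _ => ⟨⟨?_, ?_⟩, ?_, ?_, ?_⟩⟩
    · rintro a b b' ⟨h, h1⟩ ⟨h', h2⟩
      exact h1.symm.trans h2
    · rintro a a' b ⟨h, h1⟩ ⟨h', h2⟩
      have := e.injective (Subtype.ext (h1.trans h2.symm))
      exact congrArg Subtype.val this
    · rintro ⟨a, b⟩ ⟨h, h1⟩
      refine ⟨h, ?_⟩
      rw [← h1]
      exact (e ⟨a, h⟩).2
    · intro ℓ h
      exact ⟨(e ⟨ℓ, h⟩).1, h, rfl⟩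
    · intro i h
      refine ⟨(e.symm ⟨i, h⟩).1, (e.symm ⟨i, h⟩).2, ?_⟩
      show (e (e.symm ⟨i, h⟩)).1 = i
      rw [e.apply_symm_apply]
  choose M hM using hb
  have hME := fun ℓ => hM (E ℓ) (hE ℓ) (hE0 ℓ)
  refine ⟨{p | p ∈ M (E p.1)}, ⟨?_, ?_⟩, ?_, ?_, ?_⟩
  · intro a b b' h h'
    exact (hME a).1.1 a b b' h h'
  · intro a a' b h h'
    have h1 := ((hME a).2.1 _ h).2
    have h2 := ((hME a').2.1 _ h').2
    have h3 : E a = E a' := h1.symm.trans h2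
    refine (hME a).1.2 a a' b h ?_
    rw [h3]
    exact h'
  · intro p hp
    exact ((hME p.1).2.1 p hp).2.symm
  · intro ℓ
    exact (hME ℓ).2.2.1 ℓ rfl
  · intro i hi
    obtain ⟨ℓ, hℓ⟩ := (hM (G i) (hG i) hi).2.2.2 i rfl
    have h1 := ((hM (G i) (hG i) hi).2.1 _ hℓ).1
    refine ⟨ℓ, ?_⟩
    show (ℓ, i) ∈ M (E ℓ)
    have h1 : E ℓ = G i := h1
    rw [h1]
    exact hℓ

end Counting

section Key

/-- The open interval of a point of the extended half-plane. -/
def openI (p : EReal × EReal) : Set ℝ := {t | p.1 < (t : EReal) ∧ (t : EReal) < p.2}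

theorem openI_conn (p : EReal × EReal) : (openI p).OrdConnected := by
  refine ⟨fun a ha b hb c hc => ⟨ha.1.trans_le ?_, lt_of_le_of_lt ?_ hb.2⟩⟩
  · exact_mod_cast hc.1
  · exact_mod_cast hc.2

theorem decMem_of_openI {x : (EReal × Bool) × (EReal × Bool)} {t : ℝ}
    (h : t ∈ openI (x.1.1, x.2.1)) : decMem t x := ⟨Or.inl h.1, Or.inl h.2⟩

theorem openI_of_decMem {x : (EReal × Bool) × (EReal × Bool)} {r s t : ℝ}
    (hr : decMem r x) (ht : decMem t x) (h1 : r < s) (h2 : s < t) : s ∈ openI (x.1.1, x.2.1) := by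
  have h1' : (r : EReal) < s := by exact_mod_cast h1
  have h2' : (s : EReal) < t := by exact_mod_cast h2
  refine ⟨?_, ?_⟩
  · rcases hr.1 with h | h
    · exact h.trans h1'
    · exact h.1.trans_lt h1'
  · rcases ht.2 with h | h
    · exact h2'.trans h
    · exact h2'.trans_le h.1.le

/-- Pulling back a decomposition along a monotone map. -/
theorem pull_barMod {k : Type} [Field k] {S T L : Type} [Preorder S] [Preorder T]
    (W : PersMod k T) (E : L → Set T) (hE : ∀ ℓ, (E ℓ).OrdConnected) (f : S → T) (hf : Monotone f)
    (hE' : ∀ ℓ, (f ⁻¹' (E ℓ)).OrdConnected)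
    (h : PersIso W (barMod k E hE)) :
    PersIso (pullMod W f hf) (barMod k (fun ℓ => f ⁻¹' (E ℓ)) hE') := by
  obtain ⟨e, he⟩ := h
  exact ⟨fun t => e (f t), fun s t h => he (f s) (f t) (hf h)⟩

theorem interleaved_key {k : Type} [Field k] (V : PersMod k ℝ) (hV : QTame k V) {ι : Type}
    (D : ι → (EReal × Bool) × (EReal × Bool)) (hD : IsDgmOf V D) (ε : ℝ) (hε : 0 < ε) :
    Interleaved k V (barMod k (fun i : {i : ι // (D i).1.1 < (D i).2.1} =>
      openI ((D i.1).1.1, (D i.1).2.1)) (fun _ => openI_conn _)) (6 * ε) := by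
  set S := smoothing V ε hε with hS
  have hmono : Monotone (fun n : ℤ => (n : ℝ) * ε) := by
    intro m n h
    have : (m : ℝ) ≤ n := by exact_mod_cast h
    show (m : ℝ) * ε ≤ n * ε
    nlinarith
  have hfl : Monotone (fun t : ℝ => ⌊t / ε⌋) := by
    intro s t h
    exact Int.floor_mono (div_le_div_of_nonneg_right h hε.le)
  set W := pullMod S (fun n : ℤ => (n : ℝ) * ε) hmono with hW
  have hfinW : ∀ n, FiniteDimensional k (W.space n) := by
    intro n
    exact edim_lt_top (M := LinearMap.range (V.map ((n : ℝ) * ε - ε) ((n : ℝ) * ε + ε) (by linarith)))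
      (hV _ _ (by linarith))
  obtain ⟨L, E, hE, hE0, hiso⟩ := exists_decomp W hfinW
  have hrank : ∀ m n : ℤ, ∀ h : m ≤ n, ∀ h' : (m : ℝ) * ε - ε ≤ (n : ℝ) * ε + ε,
      {ℓ | m ∈ E ℓ ∧ n ∈ E ℓ}.encard = erank (V.map ((m : ℝ) * ε - ε) ((n : ℝ) * ε + ε) h') := by
    intro m n h h'
    rw [← erank_barMod (k := k) E hE h, ← erank_iso hiso h]
    exact erank_smoothing V ε hε (hmono h) h'
  set G : ι → Set ℤ := fun i => {n | decMem ((n : ℝ) * ε - ε) (D i) ∧ decMem ((n : ℝ) * ε + ε) (D i)}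
    with hGdef
  have hle : ∀ m n : ℤ, m ≤ n → (m : ℝ) * ε ≤ (n : ℝ) * ε := fun m n h => hmono h
  have hG : ∀ i, (G i).OrdConnected := by
    intro i
    refine ⟨fun a ha b hb c hc => ⟨?_, ?_⟩⟩
    · refine (decMem_convex (D i)).out ha.1 hb.2 ⟨?_, ?_⟩
      · have := hle _ _ hc.1
        linarith
      · have := hle _ _ hc.2
        linarith
    · refine (decMem_convex (D i)).out ha.1 hb.2 ⟨?_, ?_⟩
      · have := hle _ _ hc.1
        linarith
      · have := hle _ _ hc.2
        linarith
  obtain ⟨M, hM, hMeq, hML, hMI⟩ := exists_bar_matching E G hE hG hE0 (by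
      intro m n h
      have h1 := hle _ _ h
      rw [hrank m n h (by linarith), erank_dgm hD]
      congr 1
      ext i
      constructor
      · rintro ⟨ha, hb⟩
        exact ⟨⟨ha, (decMem_convex (D i)).out ha hb ⟨by linarith, by linarith⟩⟩,
          ⟨(decMem_convex (D i)).out ha hb ⟨by linarith, by linarith⟩, hb⟩⟩
      · rintro ⟨ha, hb⟩
        exact ⟨ha.1, hb.2⟩) (by
      intro n
      have h := hrank n n le_rfl (by linarith)
      simp only [and_self] at h
      rw [← Set.encard_lt_top_iff, h, lt_top_iff_ne_top]
      exact hV _ _ (by linarith))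
  have hf' : Monotone (fun t : ℝ => (⌊t / ε⌋ : ℝ) * ε) := fun s t h => hmono (hfl h)
  have hfloor1 : ∀ t : ℝ, (⌊t / ε⌋ : ℝ) * ε ≤ t := fun t => by
    have := Int.floor_le (t / ε)
    rwa [le_div_iff₀ hε] at this
  have hfloor2 : ∀ t : ℝ, t < (⌊t / ε⌋ : ℝ) * ε + ε := fun t => by
    have := Int.lt_floor_add_one (t / ε)
    rw [div_lt_iff₀ hε] at this
    linarith
  have I1 : Interleaved k V S ε := interleaved_smoothing V ε hε
  have I2 : Interleaved k S (pullMod S (fun t : ℝ => (⌊t / ε⌋ : ℝ) * ε) hf') ε := by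
    refine interleaved_pull S ε _ hf' ?_ ?_
    · intro t
      have := hfloor1 t
      linarith
    · intro t
      have := hfloor2 (t + ε)
      linarith
  have hE' : ∀ ℓ, ((fun t : ℝ => ⌊t / ε⌋) ⁻¹' (E ℓ)).OrdConnected := fun ℓ =>
    (hE ℓ).preimage_mono hfl
  have I3 : Interleaved k (pullMod S (fun t : ℝ => (⌊t / ε⌋ : ℝ) * ε) hf')
      (barMod k (fun ℓ => (fun t : ℝ => ⌊t / ε⌋) ⁻¹' (E ℓ)) hE') 0 :=
    interleaved_zero_of_iso (pull_barMod W E hE (fun t : ℝ => ⌊t / ε⌋) hfl hE' hiso)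
  have hgrid : ∀ n : ℤ, ⌊(n : ℝ) * ε / ε⌋ = n := by
    intro n
    rw [mul_div_cancel_right₀ _ hε.ne', Int.floor_intCast]
  have hpq : ∀ i, (G i).Nonempty → (D i).1.1 < (D i).2.1 := by
    rintro i ⟨n, hn⟩
    have : (n : ℝ) * ε ∈ openI ((D i).1.1, (D i).2.1) :=
      openI_of_decMem hn.1 hn.2 (by linarith) (by linarith)
    exact this.1.trans this.2
  have I4 : Interleaved k (barMod k (fun ℓ => (fun t : ℝ => ⌊t / ε⌋) ⁻¹' (E ℓ)) hE')
      (barMod k (fun i : {i : ι // (D i).1.1 < (D i).2.1} =>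
      openI ((D i.1).1.1, (D i.1).2.1)) (fun _ => openI_conn _)) (4 * ε) := by
    refine interleaved_of_matching _ _ _ _ {p | (p.1, p.2.1) ∈ M} ⟨?_, ?_⟩ ?_ ?_ ?_
    · intro a b b' h h'
      exact Subtype.ext (hM.1 _ _ _ h h')
    · intro a a' b h h'
      exact hM.2 _ _ _ h h'
    · rintro ⟨ℓ, i⟩ hp
      have heq : E ℓ = G i.1 := hMeq _ hp
      have key : ∀ s : ℝ, s ∈ (fun t : ℝ => ⌊t / ε⌋) ⁻¹' (E ℓ) ↔ ⌊s / ε⌋ ∈ G i.1 := by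
        intro s
        rw [Set.mem_preimage, heq]
      have key2 : ∀ n : ℤ, n ∈ G i.1 → (n : ℝ) * ε ∈ (fun t : ℝ => ⌊t / ε⌋) ⁻¹' (E ℓ) := by
        intro n hn
        rw [key, hgrid]
        exact hn
      refine ⟨fun s hs => ?_, fun s hs => ?_⟩
      · have hs' := (key s).1 hs
        have h1 := hfloor1 s
        have h2 := hfloor2 s
        have h3 := openI_of_decMem (s := (⌊s / ε⌋ : ℝ) * ε) hs'.1 hs'.2 (by linarith) (by linarith)
        exact ⟨⟨_, h3, by linarith⟩, ⟨_, h3, by linarith⟩⟩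
      · obtain ⟨n0, hn0⟩ := hE0 ℓ
        rw [heq] at hn0
        have hs' := decMem_of_openI hs
        have h1 := hfloor1 s
        have h2 := hfloor2 s
        constructor
        · rcases le_or_gt ((n0 : ℝ) * ε) (s + 4 * ε) with h | h
          · exact ⟨_, key2 n0 hn0, h⟩
          · refine ⟨_, key2 (⌊s / ε⌋ + 2) ⟨?_, ?_⟩, ?_⟩
            · refine (decMem_convex (D i.1)).out hs' hn0.1 ⟨?_, ?_⟩ <;> push_cast <;> linarith
            · refine (decMem_convex (D i.1)).out hs' hn0.1 ⟨?_, ?_⟩ <;> push_cast <;> linarith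
            · push_cast
              linarith
        · rcases le_or_gt s ((n0 : ℝ) * ε + 4 * ε) with h | h
          · exact ⟨_, key2 n0 hn0, h⟩
          · refine ⟨_, key2 (⌊s / ε⌋ - 1) ⟨?_, ?_⟩, ?_⟩
            · refine (decMem_convex (D i.1)).out hn0.2 hs' ⟨?_, ?_⟩ <;> push_cast <;> linarith
            · refine (decMem_convex (D i.1)).out hn0.2 hs' ⟨?_, ?_⟩ <;> push_cast <;> linarith
            · push_cast
              linarith
    · intro ℓ hℓ
      exfalso
      obtain ⟨i, hi⟩ := hML ℓ
      have heq : E ℓ = G i := hMeq _ hi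
      exact hℓ ⟨i, hpq i (heq ▸ hE0 ℓ)⟩ hi
    · intro i hi t ht ht'
      have h1 := hfloor1 t
      have h2 := hfloor2 t
      have hne : (G i.1).Nonempty := by
        refine ⟨⌊t / ε⌋ + 2, ?_, ?_⟩
        · refine (decMem_convex (D i.1)).out (decMem_of_openI ht) (decMem_of_openI ht')
            ⟨?_, ?_⟩ <;> push_cast <;> linarith
        · refine (decMem_convex (D i.1)).out (decMem_of_openI ht) (decMem_of_openI ht')
            ⟨?_, ?_⟩ <;> push_cast <;> linarith
      obtain ⟨ℓ, hℓ⟩ := hMI i.1 hne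
      exact hi ℓ hℓ
  have h4 : (0 : ℝ) ≤ 4 * ε := by linarith
  have h40 : (0 : ℝ) ≤ 0 + 4 * ε := by linarith
  have h2 : (0 : ℝ) ≤ ε + ε := by linarith
  have I12 := I1.trans' hε.le hε.le I2
  have I34 := I3.trans' le_rfl h4 I4
  have := I12.trans' h2 h40 I34
  convert this using 1
  ring

end Key

section ERealFacts

/-- Coordinatewise closeness. -/
def nearE (δ : ℝ) (x y : EReal) : Prop := x ≤ y + (δ : EReal) ∧ y ≤ x + (δ : EReal)

def nearP (δ : ℝ) (α β : EReal × EReal) : Prop := nearE δ α.1 β.1 ∧ nearE δ α.2 β.2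

/-- Points far from the diagonal. -/
def bigP (δ : ℝ) (α : EReal × EReal) : Prop := α.1 + ((δ + δ : ℝ) : EReal) < α.2

theorem eDiff_le_iff {δ : ℝ} (hδ : 0 ≤ δ) (x y : EReal) :
    eDiff x y ≤ ENNReal.ofReal δ ↔ nearE δ x y := by
  unfold eDiff nearE
  induction x with
  | bot =>
    induction y with
    | bot => simp
    | top => simp
    | coe y => simp [← EReal.coe_add]
  | top =>
    induction y with
    | bot => simp
    | top => simp
    | coe y => simp [← EReal.coe_add]
  | coe x =>
    induction y with
    | bot => simp [← EReal.coe_add]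
    | top => simp [← EReal.coe_add]
    | coe y =>
      rw [← EReal.coe_add, ← EReal.coe_add, EReal.coe_le_coe_iff, EReal.coe_le_coe_iff]
      by_cases h : x = y
      · subst h
        simp [hδ]
      · have : ¬ ((x : EReal) = y) := by exact_mod_cast h
        rw [if_neg this, if_neg (by simp), ENNReal.ofReal_le_ofReal_iff hδ]
        simp only [EReal.toReal_coe, abs_le]
        constructor
        · rintro ⟨h1, h2⟩
          constructor <;> linarith
        · rintro ⟨h1, h2⟩
          constructor <;> linarith

theorem dPt_le_iff {δ : ℝ} (hδ : 0 ≤ δ) (α β : EReal × EReal) :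
    dPt α β ≤ ENNReal.ofReal δ ↔ nearP δ α β := by
  unfold dPt nearP
  rw [max_le_iff, eDiff_le_iff hδ, eDiff_le_iff hδ]

theorem diagDist_le_iff {δ : ℝ} (hδ : 0 ≤ δ) (α : EReal × EReal) (hα : α.1 < α.2) :
    diagDist α ≤ ENNReal.ofReal δ ↔ ¬ bigP δ α := by
  obtain ⟨x, y⟩ := α
  unfold diagDist bigP
  simp only at hα ⊢
  induction x with
  | bot =>
    have : (⊥ : EReal) + ((δ + δ : ℝ) : EReal) = ⊥ := EReal.bot_add _
    rw [this]
    simp [hα]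
  | top => simp at hα
  | coe x =>
    rw [← EReal.coe_add]
    induction y with
    | bot => simp at hα
    | top =>
      rw [if_pos (Or.inr rfl)]
      have h1 := EReal.coe_lt_top (x + (δ + δ))
      simp only [top_le_iff, ENNReal.ofReal_ne_top, false_iff, not_not]
      exact h1
    | coe y =>
      rw [if_neg (by simp), ENNReal.ofReal_le_ofReal_iff hδ, EReal.coe_lt_coe_iff]
      simp only [EReal.toReal_coe]
      constructor
      · intro h h'
        linarith
      · intro h
        linarith

theorem nearE.symm {δ : ℝ} {x y : EReal} (h : nearE δ x y) : nearE δ y x := ⟨h.2, h.1⟩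

theorem add_mono_r {x y : EReal} (h : x ≤ y) (m : ℝ) : x + (m : EReal) ≤ y + (m : EReal) :=
  add_le_add_left h _

theorem add_cancel_lt {x y : EReal} {m : ℝ} (h : x + (m : EReal) < y + (m : EReal)) : x < y := by
  by_contra h'
  exact absurd (add_mono_r (not_lt.1 h') m) (not_le.2 h)

theorem add_add_coe (x : EReal) (m n : ℝ) :
    x + (m : EReal) + (n : EReal) = x + ((m + n : ℝ) : EReal) := by
  rw [add_assoc, EReal.coe_add]

theorem lt_of_add_coe_lt {x : EReal} {m t : ℝ} (h : x + (m : EReal) < (t : EReal)) :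
    x < ((t - m : ℝ) : EReal) := by
  apply add_cancel_lt (m := m)
  rw [← EReal.coe_add, sub_add_cancel]
  exact h

theorem coe_lt_of_lt_add {x : EReal} {m t : ℝ} (h : (t : EReal) < x + (m : EReal)) :
    ((t - m : ℝ) : EReal) < x := by
  apply add_cancel_lt (m := m)
  rw [← EReal.coe_add, sub_add_cancel]
  exact h

theorem le_add_of_forall {x y : EReal} {m : ℝ}
    (h : ∀ t : ℝ, x < (t : EReal) → y ≤ ((t + m : ℝ) : EReal)) : y ≤ x + (m : EReal) := by
  by_contra h'
  obtain ⟨w, hw1, hw2⟩ := EReal.lt_iff_exists_real_btwn.1 (not_le.1 h')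
  have := h (w - m) (lt_of_add_coe_lt hw1)
  rw [sub_add_cancel] at this
  exact absurd this (not_le.2 hw2)

/-- Truncation of a finite set of extended reals. -/
theorem exists_trunc (F : Finset EReal) (δ : ℝ) (hδ : 0 ≤ δ) : ∃ τ : EReal → ℝ,
    ∀ x ∈ F, ∀ z ∈ F, ∀ m : ℝ, 0 ≤ m → m ≤ δ →
      (z ≤ x + (m : EReal) → τ z ≤ τ x + m) ∧ (z + (m : EReal) < x → τ z + m < τ x) := by
  obtain ⟨K, hK⟩ : ∃ K : ℝ, δ < K ∧ ∀ x ∈ F, |x.toReal| + δ < K := by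
    refine ⟨1 + δ + ∑ x ∈ F, |x.toReal|, ?_, ?_⟩
    · have : 0 ≤ ∑ x ∈ F, |x.toReal| := Finset.sum_nonneg fun _ _ => abs_nonneg _
      linarith
    · intro x hx
      have := Finset.single_le_sum (f := fun x : EReal => |x.toReal|) (fun _ _ => abs_nonneg _) hx
      linarith
  refine ⟨fun x => if x = ⊤ then K else if x = ⊥ then -K else x.toReal, ?_⟩
  intro x hx z hz m hm hmδ
  have hKx := hK.2 x hx
  have hKz := hK.2 z hz
  have hK0 := hK.1
  induction x with
  | bot =>
    induction z with
    | bot => simp [hm]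
    | top => simp
    | coe z => simp
  | top =>
    induction z with
    | bot => simp; constructor <;> linarith
    | top => simp [hm]
    | coe z =>
      have hKz : |z| + δ < K := by simpa using hKz
      have := le_abs_self z
      have := neg_abs_le z
      simp; constructor
      · linarith
      · intro; linarith
  | coe x =>
    have hKx : |x| + δ < K := by simpa using hKx
    have := le_abs_self x
    have := neg_abs_le x
    induction z with
    | bot => simp; constructor <;> linarith
    | top => simp [← EReal.coe_add]
    | coe z =>
      rw [← EReal.coe_add, ← EReal.coe_add, EReal.coe_le_coe_iff, EReal.coe_lt_coe_iff]
      simp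

/-- Combining two partial injections into one matching. -/
theorem combine_matching {L L' : Type} (X : Set L) (Y : Set L') (f : L → L') (g : L' → L)
    (hf : Set.InjOn f X) (hg : Set.InjOn g Y) :
    ∃ M : Set (L × L'), IsMatching M ∧
      (∀ p ∈ M, (p.1 ∈ X ∧ f p.1 = p.2) ∨ (p.2 ∈ Y ∧ g p.2 = p.1)) ∧
      (∀ a ∈ X, ∃ b, (a, b) ∈ M) ∧ (∀ b ∈ Y, ∃ a, (a, b) ∈ M) := by
  let Φ : Set L →o Set L := ⟨fun S => X \ g '' (Y \ f '' S), by
    intro S T h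
    exact Set.diff_subset_diff_right (Set.image_mono (Set.diff_subset_diff_right
      (Set.image_mono h)))⟩
  set S := OrderHom.lfp Φ with hS
  have hfix : X \ g '' (Y \ f '' S) = S := OrderHom.map_lfp Φ
  have hSX : S ⊆ X := by
    rw [← hfix]
    exact Set.diff_subset
  refine ⟨{p | (p.1 ∈ S ∧ f p.1 = p.2) ∨ (p.2 ∈ Y \ f '' S ∧ g p.2 = p.1)}, ⟨?_, ?_⟩, ?_, ?_, ?_⟩
  · rintro a b b' (⟨h1, h2⟩ | ⟨h1, h2⟩) (⟨h3, h4⟩ | ⟨h3, h4⟩)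
    · exact h2.symm.trans h4
    · exfalso
      rw [← hfix] at h1
      exact h1.2 ⟨b', h3, h4⟩
    · exfalso
      rw [← hfix] at h3
      exact h3.2 ⟨b, h1, h2⟩
    · exact hg h1.1 h3.1 (h2.trans h4.symm)
  · rintro a b b' (⟨h1, h2⟩ | ⟨h1, h2⟩) (⟨h3, h4⟩ | ⟨h3, h4⟩)
    · exact hf (hSX h1) (hSX h3) (h2.trans h4.symm)
    · exfalso
      exact h3.2 ⟨a, h1, h2⟩
    · exfalso
      exact h1.2 ⟨b, h3, h4⟩
    · exact h2.symm.trans h4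
  · rintro p (h | h)
    · exact Or.inl ⟨hSX h.1, h.2⟩
    · exact Or.inr ⟨h.1.1, h.2⟩
  · intro a ha
    by_cases h : a ∈ S
    · exact ⟨f a, Or.inl ⟨h, rfl⟩⟩
    · rw [← hfix] at h
      have : a ∈ g '' (Y \ f '' S) := by
        by_contra h'
        exact h ⟨ha, h'⟩
      obtain ⟨b, hb, hba⟩ := this
      exact ⟨b, Or.inr ⟨hb, hba⟩⟩
  · intro b hb
    by_cases h : b ∈ f '' S
    · obtain ⟨a, ha, hab⟩ := h
      exact ⟨a, Or.inl ⟨ha, hab⟩⟩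
    · exact ⟨g b, Or.inr ⟨⟨hb, h⟩, rfl⟩⟩

end ERealFacts

section Matrices

/-- The basis vector of a bar. -/
noncomputable def eV (k : Type) [Field k] {T L : Type} (J : L → Set T) (a : L) (t : T)
    (h : t ∈ J a) : barSp k J t :=
  ⟨Finsupp.single a 1, by
    intro ℓ hℓ
    rw [Finsupp.single_apply, if_neg]
    rintro rfl
    exact hℓ h⟩

theorem barProj_eV {k : Type} [Field k] {T L : Type} (J : L → Set T) (a : L) (s t : T)
    (h : s ∈ J a) (h' : t ∈ J a) : barProj k J t (eV k J a s h).1 = eV k J a t h' := by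
  refine Subtype.ext (Finsupp.ext fun ℓ => ?_)
  rw [barProj_apply]
  show (if t ∈ J ℓ then Finsupp.single a (1 : k) ℓ else 0) = Finsupp.single a (1 : k) ℓ
  split_ifs with h1
  · rfl
  · rw [Finsupp.single_apply, if_neg]
    rintro rfl
    exact h1 h'

theorem barProj_eV_zero {k : Type} [Field k] {T L : Type} (J : L → Set T) (a : L) (s t : T)
    (h : s ∈ J a) (h' : t ∉ J a) : barProj k J t (eV k J a s h).1 = 0 := by
  refine Subtype.ext (Finsupp.ext fun ℓ => ?_)
  rw [barProj_apply]
  show (if t ∈ J ℓ then Finsupp.single a (1 : k) ℓ else 0) = 0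
  split_ifs with h1
  · rw [Finsupp.single_apply, if_neg]
    rintro rfl
    exact h' h1
  · rfl

theorem exists_matrix {k : Type} [Field k] {L L' : Type} (J : L → Set ℝ) (J' : L' → Set ℝ) {δ : ℝ}
    (φ : ∀ t, barSp k J t →ₗ[k] barSp k J' (t + δ))
    (hφ : ∀ s t, s ≤ t → ∀ x : barSp k J s,
      φ t (barProj k J t x.1) = barProj k J' (t + δ) (φ s x).1) :
    ∃ c : L → L' → k,
      (∀ a b, c a b ≠ 0 → (∀ s ∈ J a, ∃ u ∈ J' b, u ≤ s + δ) ∧ (∀ u ∈ J' b, ∃ s ∈ J a, u ≤ s + δ)) ∧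
      (∀ t a (h : t ∈ J a) b, t + δ ∈ J' b → (φ t (eV k J a t h)).1 b = c a b) := by
  have hconst : ∀ s t a (hs : s ∈ J a) (ht : t ∈ J a) b, s ≤ t → t + δ ∈ J' b →
      (φ t (eV k J a t ht)).1 b = (φ s (eV k J a s hs)).1 b := by
    intro s t a hs ht b hst hb
    rw [← barProj_eV J a s t hs ht, hφ s t hst, barProj_apply, if_pos hb]
  have hconst' : ∀ s t a (hs : s ∈ J a) (ht : t ∈ J a) b, s + δ ∈ J' b → t + δ ∈ J' b →
      (φ t (eV k J a t ht)).1 b = (φ s (eV k J a s hs)).1 b := by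
    intro s t a hs ht b hb hb'
    rcases le_total s t with h | h
    · exact hconst s t a hs ht b h hb'
    · exact (hconst t s a ht hs b h hb).symm
  refine ⟨fun a b => if h : ∃ t, t ∈ J a ∧ t + δ ∈ J' b then
    (φ h.choose (eV k J a h.choose h.choose_spec.1)).1 b else 0, ?_, ?_⟩
  · intro a b hne
    by_cases h : ∃ t, t ∈ J a ∧ t + δ ∈ J' b
    swap
    · exact absurd (dif_neg h) hne
    beta_reduce at hne
    rw [dif_pos h] at hne
    obtain ⟨h1, h2⟩ := h.choose_spec
    set t0 := h.choose
    constructor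
    · intro s hs
      rcases le_total s t0 with hst | hst
      · refine ⟨s + δ, ?_, le_rfl⟩
        rw [hconst s t0 a hs h1 b hst h2] at hne
        by_contra hb
        exact hne ((φ s _).2 b hb)
      · exact ⟨t0 + δ, h2, by linarith⟩
    · intro u hu
      by_contra hcon
      push Not at hcon
      have h3 := hcon t0 h1
      have h4 : u - δ ∉ J a := fun h => by
        have := hcon _ h
        linarith
      have h5 := hφ t0 (u - δ) (by linarith) (eV k J a t0 h1)
      rw [barProj_eV_zero J a t0 _ h1 h4, map_zero] at h5
      have h6 := congrArg (fun z : barSp k J' (u - δ + δ) => z.1 b) h5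
      beta_reduce at h6
      rw [barProj_apply, if_pos (by simpa using hu)] at h6
      exact hne h6.symm
  · intro t a ht b hb
    have h : ∃ t, t ∈ J a ∧ t + δ ∈ J' b := ⟨t, ht, hb⟩
    beta_reduce
    rw [dif_pos h]
    exact hconst' _ _ _ _ _ _ h.choose_spec.2 hb

theorem barSp_sum {k : Type} [Field k] {T L : Type} (J : L → Set T) (t : T) {N : Type}
    [AddCommGroup N] [Module k N] (ψ : barSp k J t →ₗ[k] N) (x : barSp k J t) :
    ψ x = ∑ b ∈ x.1.support, if h : t ∈ J b then x.1 b • ψ (eV k J b t h) else 0 := by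
  have hx : x = ∑ b ∈ x.1.support, if h : t ∈ J b then x.1 b • eV k J b t h else 0 := by
    refine Subtype.ext ?_
    conv_lhs => rw [← Finsupp.sum_single x.1]
    rw [Finsupp.sum, AddSubmonoidClass.coe_finsetSum]
    refine Finset.sum_congr rfl fun b hb => ?_
    have h : t ∈ J b := by
      by_contra h
      exact (Finsupp.mem_support_iff.1 hb) (x.2 b h)
    rw [dif_pos h]
    show _ = x.1 b • Finsupp.single b (1 : k)
    rw [Finsupp.smul_single, smul_eq_mul, mul_one]
  conv_lhs => rw [hx]
  rw [map_sum]
  refine Finset.sum_congr rfl fun b hb => ?_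
  split_ifs with h
  · rw [map_smul]
  · rw [map_zero]

theorem matrix_comp {k : Type} [Field k] {L L' : Type} (J : L → Set ℝ) (J' : L' → Set ℝ)
    (hJ' : ∀ b, (J' b).OrdConnected) {δ : ℝ}
    (φ : ∀ t, barSp k J t →ₗ[k] barSp k J' (t + δ))
    (ψ : ∀ t, barSp k J' t →ₗ[k] barSp k J (t + δ))
    (hψφ : ∀ t (x : barSp k J t), ψ (t + δ) (φ t x) = barProj k J (t + δ + δ) x.1)
    (c : L → L' → k) (c' : L' → L → k)
    (h1 : ∀ a b, c a b ≠ 0 →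
      (∀ s ∈ J a, ∃ u ∈ J' b, u ≤ s + δ) ∧ (∀ u ∈ J' b, ∃ s ∈ J a, u ≤ s + δ))
    (h2 : ∀ t a (h : t ∈ J a) b, t + δ ∈ J' b → (φ t (eV k J a t h)).1 b = c a b)
    (h1' : ∀ b a, c' b a ≠ 0 →
      (∀ s ∈ J' b, ∃ u ∈ J a, u ≤ s + δ) ∧ (∀ u ∈ J a, ∃ s ∈ J' b, u ≤ s + δ))
    (h2' : ∀ t b (h : t ∈ J' b) a, t + δ ∈ J a → (ψ t (eV k J' b t h)).1 a = c' b a)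
    (t : ℝ) (a a' : L) (ha : t ∈ J a) (ha' : t + δ + δ ∈ J a') (N : Finset L')
    (hN : ∀ b, c a b ≠ 0 → c' b a' ≠ 0 → b ∈ N) :
    ∑ b ∈ N, c a b * c' b a' = if a = a' then 1 else 0 := by
  have e1 := congrArg (fun z : barSp k J (t + δ + δ) => z.1 a') (hψφ t (eV k J a t ha))
  beta_reduce at e1
  rw [barProj_apply, if_pos ha'] at e1
  have e2 : (eV k J a t ha).1 a' = if a = a' then 1 else 0 := Finsupp.single_apply
  rw [e2] at e1
  rw [← e1]
  set x := φ t (eV k J a t ha) with hx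
  let ev : barSp k J (t + δ + δ) →ₗ[k] k := Finsupp.lapply a' ∘ₗ (barSp k J (t + δ + δ)).subtype
  have e3 : (ψ (t + δ) x).1 a' = (ev ∘ₗ ψ (t + δ)) x := rfl
  rw [e3, barSp_sum J' (t + δ) (ev ∘ₗ ψ (t + δ)) x]
  have e4 : ∀ b, (if h : t + δ ∈ J' b then x.1 b • (ev ∘ₗ ψ (t + δ)) (eV k J' b (t + δ) h) else 0)
      = c a b * c' b a' := by
    intro b
    split_ifs with h
    · have : (ev ∘ₗ ψ (t + δ)) (eV k J' b (t + δ) h) = c' b a' := h2' (t + δ) b h a' ha'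
      rw [this, hx, h2 t a ha b h, smul_eq_mul]
    · by_contra hne
      have hc : c a b ≠ 0 := fun h => hne (by rw [h, zero_mul])
      have hc' : c' b a' ≠ 0 := fun h => hne (by rw [h, mul_zero])
      obtain ⟨u, hu, hu'⟩ := (h1 a b hc).1 t ha
      obtain ⟨v, hv, hv'⟩ := (h1' b a' hc').2 _ ha'
      exact h ((hJ' b).out hu hv ⟨hu', by linarith⟩)
  simp_rw [e4]
  have e5 : ∀ b, b ∉ x.1.support → t + δ ∈ J' b → c a b = 0 := by
    intro b hb h
    rw [← h2 t a ha b h]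
    exact Finsupp.notMem_support_iff.1 hb
  have e6 : ∀ b, b ∉ x.1.support → c a b * c' b a' = 0 := by
    intro b hb
    rw [← e4]
    split_ifs with h
    · rw [Finsupp.notMem_support_iff.1 hb, zero_smul]
    · rfl
  have e7 : ∀ b, b ∉ N → c a b * c' b a' = 0 := by
    intro b hb
    by_contra hne
    have hc : c a b ≠ 0 := fun h => hne (by rw [h, zero_mul])
    have hc' : c' b a' ≠ 0 := fun h => hne (by rw [h, mul_zero])
    exact hb (hN b hc hc')
  rw [Finset.sum_subset (Finset.subset_union_left (s₂ := x.1.support)) (fun b _ hb => e7 b hb),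
    Finset.sum_subset (Finset.subset_union_right (s₁ := N)) (fun b _ hb => e6 b hb)]

end Matrices

section Stability

theorem score_lt (τ : EReal → ℝ) (δ : ℝ) (hδ : 0 ≤ δ) (F : Finset EReal)
    (hτ : ∀ x ∈ F, ∀ z ∈ F, ∀ m : ℝ, 0 ≤ m → m ≤ δ + δ →
      (z ≤ x + (m : EReal) → τ z ≤ τ x + m) ∧ (z + (m : EReal) < x → τ z + m < τ x))
    (x y z : EReal × EReal) (hx1 : x.1 ∈ F) (hx2 : x.2 ∈ F) (hz1 : z.1 ∈ F) (hz2 : z.2 ∈ F)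
    (hxy1 : y.1 ≤ x.1 + (δ : EReal)) (hxy2 : y.2 ≤ x.2 + (δ : EReal))
    (hyz1 : z.1 ≤ y.1 + (δ : EReal)) (hyz2 : z.2 ≤ y.2 + (δ : EReal))
    (hnx : ¬ nearP δ x y) (hnz : ¬ nearP δ z y) :
    τ z.1 + τ z.2 < τ x.1 + τ x.2 := by
  have T0 : ∀ x y z : EReal, x ∈ F → z ∈ F → y ≤ x + (δ : EReal) → z ≤ y + (δ : EReal) →
      τ z ≤ τ x + (δ + δ) := by
    intro x y z hx hz h1 h2
    refine (hτ x hx z hz (δ + δ) (by linarith) le_rfl).1 ?_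
    rw [← add_add_coe]
    exact h2.trans (add_mono_r h1 δ)
  have Tlt : ∀ x z : EReal, x ∈ F → z ∈ F → z < x → τ z < τ x := by
    intro x z hx hz h
    have := (hτ x hx z hz 0 le_rfl (by linarith)).2 (by simpa using h)
    linarith
  have T1 : ∀ x y z : EReal, x ∈ F → z ∈ F → y + (δ : EReal) < x → z ≤ y + (δ : EReal) →
      τ z < τ x := fun x y z hx hz h1 h2 => Tlt x z hx hz (h2.trans_lt h1)
  have T2 : ∀ x y z : EReal, x ∈ F → z ∈ F → y ≤ x + (δ : EReal) → z + (δ : EReal) < y →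
      τ z < τ x := fun x y z hx hz h1 h2 => Tlt x z hx hz (add_cancel_lt (h2.trans_le h1))
  have T3 : ∀ x y z : EReal, x ∈ F → z ∈ F → y + (δ : EReal) < x → z + (δ : EReal) < y →
      τ z + (δ + δ) < τ x := by
    intro x y z hx hz h1 h2
    refine (hτ x hx z hz (δ + δ) (by linarith) le_rfl).2 ?_
    rw [← add_add_coe]
    exact (add_mono_r h2.le δ).trans_lt h1
  have hx' : y.1 + (δ : EReal) < x.1 ∨ y.2 + (δ : EReal) < x.2 := by
    by_contra hcon
    push Not at hcon
    exact hnx ⟨⟨hcon.1, hxy1⟩, ⟨hcon.2, hxy2⟩⟩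
  have hz' : z.1 + (δ : EReal) < y.1 ∨ z.2 + (δ : EReal) < y.2 := by
    by_contra hcon
    push Not at hcon
    exact hnz ⟨⟨hyz1, hcon.1⟩, ⟨hyz2, hcon.2⟩⟩
  rcases hx' with h | h <;> rcases hz' with h' | h'
  · have := T3 _ _ _ hx1 hz1 h h'
    have := T0 _ _ _ hx2 hz2 hxy2 hyz2
    linarith
  · have := T1 _ _ _ hx1 hz1 h hyz1
    have := T2 _ _ _ hx2 hz2 hxy2 h'
    linarith
  · have := T1 _ _ _ hx2 hz2 h hyz2
    have := T2 _ _ _ hx1 hz1 hxy1 h'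
    linarith
  · have := T3 _ _ _ hx2 hz2 h h'
    have := T0 _ _ _ hx1 hz1 hxy1 hyz1
    linarith

theorem hall_card {k : Type} [Field k] {L L' : Type} (A : L → EReal × EReal) (B : L' → EReal × EReal)
    (δ : ℝ) (hδ : 0 ≤ δ) (c : L → L' → k) (c' : L' → L → k)
    (hc : ∀ a b, c a b ≠ 0 → (B b).1 ≤ (A a).1 + (δ : EReal) ∧ (B b).2 ≤ (A a).2 + (δ : EReal))
    (hc' : ∀ b a, c' b a ≠ 0 → (A a).1 ≤ (B b).1 + (δ : EReal) ∧ (A a).2 ≤ (B b).2 + (δ : EReal))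
    (hcomp : ∀ (t : ℝ) (a a' : L), t ∈ openI (A a) → t + δ + δ ∈ openI (A a') → ∀ N : Finset L',
      (∀ b, c a b ≠ 0 → c' b a' ≠ 0 → b ∈ N) →
      ∑ b ∈ N, c a b * c' b a' = if a = a' then 1 else 0)
    (S : Finset L) (hS : ∀ a ∈ S, bigP δ (A a)) (N : Finset L')
    (hN : ∀ a ∈ S, ∀ b, nearP δ (A a) (B b) → b ∈ N) : S.card ≤ N.card := by
  by_contra hlt
  push Not at hlt
  -- a nontrivial relation among the rows
  obtain ⟨v, hv0, hv⟩ : ∃ v : S → k, v ≠ 0 ∧ ∀ b ∈ N, ∑ a : S, v a * c a.1 b = 0 := by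
    let f : (S → k) →ₗ[k] (N → k) :=
      { toFun := fun v b => ∑ a : S, v a * c a.1 b.1
        map_add' := fun v w => by
          funext b
          simp [add_mul, Finset.sum_add_distrib]
        map_smul' := fun r v => by
          funext b
          simp [Finset.mul_sum, mul_assoc] }
    have hker : LinearMap.ker f ≠ ⊥ := by
      apply LinearMap.ker_ne_bot_of_finrank_lt
      simpa using hlt
    obtain ⟨v, hv, hv0⟩ := Submodule.exists_mem_ne_zero_of_ne_bot hker
    exact ⟨v, hv0, fun b hb => congrFun (LinearMap.mem_ker.1 hv) ⟨b, hb⟩⟩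
  let F : Finset EReal := S.image (fun a => (A a).1) ∪ S.image (fun a => (A a).2)
  have hF1 : ∀ a ∈ S, (A a).1 ∈ F := fun a ha =>
    Finset.mem_union_left _ (Finset.mem_image_of_mem _ ha)
  have hF2 : ∀ a ∈ S, (A a).2 ∈ F := fun a ha =>
    Finset.mem_union_right _ (Finset.mem_image_of_mem (fun a => (A a).2) ha)
  obtain ⟨τ, hτ⟩ := exists_trunc F (δ + δ) (by linarith)
  have hsupp : (Finset.univ.filter fun a : S => v a ≠ 0).Nonempty := by
    obtain ⟨a, ha⟩ := Function.ne_iff.1 hv0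
    exact ⟨a, by simpa using ha⟩
  obtain ⟨a', ha', hmax⟩ := Finset.exists_max_image _
    (fun a : S => τ (A a.1).1 + τ (A a.1).2) hsupp
  have hva' : v a' ≠ 0 := by simpa using ha'
  have key : ∀ a : S, v a ≠ 0 → ∑ b ∈ N, c a.1 b * c' b a'.1 = if a.1 = a'.1 then 1 else 0 := by
    intro a hva
    have hsc := hmax a (by simpa using hva)
    by_cases hex : ∃ b, c a.1 b ≠ 0 ∧ c' b a'.1 ≠ 0
    · by_cases hq : (A a'.1).2 ≤ (A a.1).1 + ((δ + δ : ℝ) : EReal)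
      · exfalso
        have h1 := (hτ _ (hF1 _ a.2) _ (hF2 _ a'.2) (δ + δ) (by linarith) le_rfl).1 hq
        have h2 := (hτ _ (hF2 _ a.2) _ (hF1 _ a.2) (δ + δ) (by linarith) le_rfl).2 (hS _ a.2)
        have h3 := (hτ _ (hF2 _ a'.2) _ (hF1 _ a'.2) (δ + δ) (by linarith) le_rfl).2 (hS _ a'.2)
        beta_reduce at hsc
        linarith
      · obtain ⟨b0, hb0, hb0'⟩ := hex
        have e1 : (A a'.1).1 ≤ (A a.1).1 + ((δ + δ : ℝ) : EReal) := by
          rw [← add_add_coe]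
          exact (hc' _ _ hb0').1.trans (add_mono_r (hc _ _ hb0).1 δ)
        have e2 : (A a'.1).2 ≤ (A a.1).2 + ((δ + δ : ℝ) : EReal) := by
          rw [← add_add_coe]
          exact (hc' _ _ hb0').2.trans (add_mono_r (hc _ _ hb0).2 δ)
        obtain ⟨w, hw1, hw2⟩ := EReal.lt_iff_exists_real_btwn.1 (not_le.1 hq)
        refine hcomp (w - (δ + δ)) a.1 a'.1 ⟨lt_of_add_coe_lt hw1, ?_⟩ ?_ N ?_
        · exact coe_lt_of_lt_add (hw2.trans_le e2)
        · have : w - (δ + δ) + δ + δ = w := by ring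
          rw [this]
          exact ⟨e1.trans_lt hw1, hw2⟩
        · intro b hb hb'
          by_contra hbN
          have := score_lt τ δ hδ F hτ (A a.1) (B b) (A a'.1) (hF1 _ a.2) (hF2 _ a.2)
            (hF1 _ a'.2) (hF2 _ a'.2) (hc _ _ hb).1 (hc _ _ hb).2 (hc' _ _ hb').1 (hc' _ _ hb').2
            (fun h => hbN (hN _ a.2 b h)) (fun h => hbN (hN _ a'.2 b h))
          beta_reduce at hsc
          linarith
    · push Not at hex
      have hz : ∀ b, c a.1 b * c' b a'.1 = 0 := by
        intro b
        by_cases h : c a.1 b = 0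
        · rw [h, zero_mul]
        · rw [hex b h, mul_zero]
      rw [Finset.sum_eq_zero (fun b _ => hz b)]
      split_ifs with haa
      · exfalso
        obtain ⟨w, hw1, hw2⟩ := EReal.lt_iff_exists_real_btwn.1 (hS _ a.2)
        have h1 := hcomp (w - (δ + δ)) a.1 a'.1 ⟨lt_of_add_coe_lt hw1, ?_⟩ ?_ ∅ ?_
        · rw [if_pos haa] at h1
          simp at h1
        · refine lt_of_le_of_lt ?_ hw2
          exact_mod_cast (by linarith : w - (δ + δ) ≤ w)
        · have : w - (δ + δ) + δ + δ = w := by ring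
          rw [this, ← haa]
          refine ⟨lt_of_le_of_lt ?_ hw1, hw2⟩
          have : (A a.1).1 + ((0 : ℝ) : EReal) ≤ (A a.1).1 + ((δ + δ : ℝ) : EReal) := by
            gcongr
            exact_mod_cast (by linarith : (0 : ℝ) ≤ δ + δ)
          simpa using this
        · intro b hb hb'
          exact absurd (hex b hb) hb'
      · rfl
  have h0 : ∑ a : S, v a * ∑ b ∈ N, c a.1 b * c' b a'.1 = 0 := by
    simp_rw [Finset.mul_sum]
    rw [Finset.sum_comm]
    refine Finset.sum_eq_zero fun b hb => ?_
    simp_rw [← mul_assoc]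
    rw [← Finset.sum_mul, hv b hb, zero_mul]
  have h1 : ∑ a : S, v a * ∑ b ∈ N, c a.1 b * c' b a'.1 = v a' := by
    rw [Finset.sum_eq_single a']
    · rw [key a' hva', if_pos rfl, mul_one]
    · intro a _ haa
      by_cases hva : v a = 0
      · rw [hva, zero_mul]
      · rw [key a hva, if_neg (fun h => haa (Subtype.ext h)), mul_zero]
    · intro h
      exact absurd (Finset.mem_univ _) h
  exact hva' (h1.symm.trans h0)

theorem hall_inj {k : Type} [Field k] {L L' : Type} (A : L → EReal × EReal) (B : L' → EReal × EReal)
    (δ : ℝ) (hδ : 0 ≤ δ) (c : L → L' → k) (c' : L' → L → k)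
    (hc : ∀ a b, c a b ≠ 0 → (B b).1 ≤ (A a).1 + (δ : EReal) ∧ (B b).2 ≤ (A a).2 + (δ : EReal))
    (hc' : ∀ b a, c' b a ≠ 0 → (A a).1 ≤ (B b).1 + (δ : EReal) ∧ (A a).2 ≤ (B b).2 + (δ : EReal))
    (hcomp : ∀ (t : ℝ) (a a' : L), t ∈ openI (A a) → t + δ + δ ∈ openI (A a') → ∀ N : Finset L',
      (∀ b, c a b ≠ 0 → c' b a' ≠ 0 → b ∈ N) →
      ∑ b ∈ N, c a b * c' b a' = if a = a' then 1 else 0)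
    (hfin : ∀ s t : ℝ, s < t → {b | s ∈ openI (B b) ∧ t ∈ openI (B b)}.Finite) :
    ∃ f : {a : L // bigP δ (A a)} → L', Function.Injective f ∧ ∀ a, nearP δ (A a.1) (B (f a)) := by
  have hnf : ∀ a : {a : L // bigP δ (A a)}, {b | nearP δ (A a.1) (B b)}.Finite := by
    rintro ⟨a, ha⟩
    obtain ⟨w1, hw1, hw1'⟩ := EReal.lt_iff_exists_real_btwn.1 ha
    obtain ⟨w2, hw2, hw2'⟩ := EReal.lt_iff_exists_real_btwn.1 hw1'
    have hw : w1 < w2 := by exact_mod_cast hw2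
    refine (hfin (w1 - δ) (w2 - δ) (by linarith)).subset ?_
    rintro b ⟨⟨h1, h2⟩, ⟨h3, h4⟩⟩
    have e1 : (B b).1 < ((w1 - δ : ℝ) : EReal) := by
      refine lt_of_add_coe_lt (lt_of_le_of_lt ?_ hw1)
      rw [← add_add_coe]
      exact add_mono_r h2 δ
    have e2 : ((w2 - δ : ℝ) : EReal) < (B b).2 := coe_lt_of_lt_add (hw2'.trans_le h3)
    have e3 : ((w1 - δ : ℝ) : EReal) < ((w2 - δ : ℝ) : EReal) := by
      exact_mod_cast (by linarith : w1 - δ < w2 - δ)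
    exact ⟨⟨e1, e3.trans e2⟩, ⟨e1.trans e3, e2⟩⟩
  obtain ⟨f, hf, hf'⟩ := (Finset.all_card_le_biUnion_card_iff_exists_injective
    (fun a => (hnf a).toFinset)).1 (by
      intro S
      have := hall_card A B δ hδ c c' hc hc' hcomp (S.map ⟨Subtype.val, Subtype.val_injective⟩)
        (by
          intro a ha
          obtain ⟨x, _, rfl⟩ := Finset.mem_map.1 ha
          exact x.2)
        (S.biUnion fun a => (hnf a).toFinset)
        (by
          intro a ha b hb
          obtain ⟨x, hx, rfl⟩ := Finset.mem_map.1 ha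
          exact Finset.mem_biUnion.2 ⟨x, hx, (Set.Finite.mem_toFinset _).2 hb⟩)
      simpa using this)
  exact ⟨f, hf, fun a => (hnf a).mem_toFinset.1 (hf' a)⟩

theorem exists_ext {L L' : Type} (P : L → Prop) (f : {a : L // P a} → L')
    (hf : Function.Injective f) (a0 : L → L') :
    ∃ g : L → L', Set.InjOn g {a | P a} ∧ ∀ a (h : P a), g a = f ⟨a, h⟩ := by
  refine ⟨fun a => if h : P a then f ⟨a, h⟩ else a0 a, ?_, ?_⟩
  · intro a ha a' ha' h
    have ha : P a := ha
    have ha' : P a' := ha'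
    beta_reduce at h
    rw [dif_pos ha, dif_pos ha'] at h
    exact congrArg Subtype.val (hf h)
  · intro a h
    beta_reduce
    rw [dif_pos h]

theorem matching_of_interleaved {k : Type} [Field k] {L L' : Type} (A : L → EReal × EReal)
    (B : L' → EReal × EReal) (hA : ∀ a, (A a).1 < (A a).2) (hB : ∀ b, (B b).1 < (B b).2)
    (hfinA : ∀ s t : ℝ, s < t → {b | s ∈ openI (A b) ∧ t ∈ openI (A b)}.Finite)
    (hfinB : ∀ s t : ℝ, s < t → {b | s ∈ openI (B b) ∧ t ∈ openI (B b)}.Finite)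
    (δ : ℝ) (hδ : 0 ≤ δ)
    (h : Interleaved k (barMod k (fun a => openI (A a)) (fun _ => openI_conn _))
      (barMod k (fun b => openI (B b)) (fun _ => openI_conn _)) δ) :
    IsDeltaMatching A B (ENNReal.ofReal δ) := by
  obtain ⟨φ, ψ, hφ, hψ, hψφ, hφψ⟩ := h
  obtain ⟨c, c1, c2⟩ := exists_matrix (fun a => openI (A a)) (fun b => openI (B b)) φ
    (fun s t hst x => LinearMap.congr_fun (hφ s t hst) x)
  obtain ⟨c', c1', c2'⟩ := exists_matrix (fun b => openI (B b)) (fun a => openI (A a)) ψ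
    (fun s t hst x => LinearMap.congr_fun (hψ s t hst) x)
  have conv : ∀ x y : EReal × EReal, x.1 < x.2 → y.1 < y.2 →
      (∀ s ∈ openI x, ∃ u ∈ openI y, u ≤ s + δ) ∧ (∀ u ∈ openI y, ∃ s ∈ openI x, u ≤ s + δ) →
      y.1 ≤ x.1 + (δ : EReal) ∧ y.2 ≤ x.2 + (δ : EReal) := by
    rintro x y hx hy ⟨h1, h2⟩
    constructor
    · refine le_add_of_forall fun t ht => ?_
      obtain ⟨w, hw1, hw2⟩ := EReal.lt_iff_exists_real_btwn.1 (lt_min ht hx)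
      obtain ⟨u, hu, hu'⟩ := h1 w ⟨hw1, hw2.trans_le (min_le_right _ _)⟩
      have hwt : w < t := by exact_mod_cast hw2.trans_le (min_le_left _ _)
      refine hu.1.le.trans ?_
      exact_mod_cast (by linarith : u ≤ t + δ)
    · by_contra hcon
      obtain ⟨w, hw1, hw2⟩ := EReal.lt_iff_exists_real_btwn.1 (max_lt (not_le.1 hcon) hy)
      obtain ⟨s, hs, hs'⟩ := h2 w ⟨(le_max_right _ _).trans_lt hw1, hw2⟩
      have : ((s + δ : ℝ) : EReal) < (w : EReal) := by
        refine lt_of_le_of_lt ?_ ((le_max_left _ _).trans_lt hw1)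
        rw [EReal.coe_add]
        exact add_mono_r hs.2.le δ
      have : s + δ < w := by exact_mod_cast this
      linarith
  have hc := fun a b hne => conv (A a) (B b) (hA a) (hB b) (c1 a b hne)
  have hc' := fun b a hne => conv (B b) (A a) (hB b) (hA a) (c1' b a hne)
  obtain ⟨f, hf, hfn⟩ := hall_inj A B δ hδ c c' hc hc'
    (fun t a a' ha ha' N hN => matrix_comp (fun a => openI (A a)) (fun b => openI (B b))
      (fun _ => openI_conn _) φ ψ
      (fun t x => LinearMap.congr_fun (hψφ t (by linarith)) x)
      c c' c1 c2 c1' c2' t a a' ha ha' N hN) hfinB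
  obtain ⟨g, hg, hgn⟩ := hall_inj B A δ hδ c' c hc' hc
    (fun t a a' ha ha' N hN => matrix_comp (fun b => openI (B b)) (fun a => openI (A a))
      (fun _ => openI_conn _) ψ φ
      (fun t x => LinearMap.congr_fun (hφψ t (by linarith)) x)
      c' c c1' c2' c1 c2 t a a' ha ha' N hN) hfinA
  by_cases hL : Nonempty L ∧ Nonempty L'
  · obtain ⟨⟨l0⟩, ⟨l0'⟩⟩ := hL
    obtain ⟨F, hF, hFf⟩ := exists_ext _ f hf (fun _ => l0')
    obtain ⟨G, hG, hGg⟩ := exists_ext _ g hg (fun _ => l0)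
    obtain ⟨M, hM, h1, h2, h3⟩ := combine_matching _ _ F G hF hG
    refine ⟨M, hM, ?_, ?_, ?_⟩
    · intro p hp
      rw [dPt_le_iff hδ]
      rcases h1 p hp with ⟨ha, hb⟩ | ⟨ha, hb⟩
      · rw [← hb, hFf _ ha]
        exact hfn ⟨_, ha⟩
      · rw [← hb, hGg _ ha]
        have := hgn ⟨_, ha⟩
        exact ⟨this.1.symm, this.2.symm⟩
    · intro a ha
      rw [diagDist_le_iff hδ _ (hA a)]
      intro hbig
      obtain ⟨b, hb⟩ := h2 a hbig
      exact ha b hb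
    · intro b hb
      rw [diagDist_le_iff hδ _ (hB b)]
      intro hbig
      obtain ⟨a, ha⟩ := h3 b hbig
      exact hb a ha
  · refine ⟨∅, ⟨by simp, by simp⟩, by simp, ?_, ?_⟩
    · intro a _
      rw [diagDist_le_iff hδ _ (hA a)]
      intro hbig
      exact hL ⟨⟨a⟩, ⟨f ⟨a, hbig⟩⟩⟩
    · intro b _
      rw [diagDist_le_iff hδ _ (hB b)]
      intro hbig
      exact hL ⟨⟨g ⟨b, hbig⟩⟩, ⟨b⟩⟩

end Stability

section Assembly

theorem nearSet_half {δ : ℝ} {x y : EReal × EReal} (hy : y.1 < y.2) (h : nearP δ x y) :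
    ∀ s ∈ openI x, (∃ u ∈ openI y, u ≤ s + δ) ∧ (∃ u ∈ openI y, s ≤ u + δ) := by
  obtain ⟨⟨h1, h2⟩, ⟨h3, h4⟩⟩ := h
  rintro s ⟨hs1, hs2⟩
  constructor
  · have e : y.1 < ((s + δ : ℝ) : EReal) := by
      refine lt_of_le_of_lt h2 ?_
      by_contra hcon
      have hcon := not_lt.1 hcon
      obtain ⟨w, hw1, hw2⟩ := EReal.lt_iff_exists_real_btwn.1 hs1
      have hws : w < s := by exact_mod_cast hw2
      have := hcon.trans (add_mono_r hw1.le δ)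
      rw [← EReal.coe_add, EReal.coe_le_coe_iff] at this
      linarith
    obtain ⟨u, hu1, hu2⟩ := EReal.lt_iff_exists_real_btwn.1 (lt_min e hy)
    refine ⟨u, ⟨hu1, hu2.trans_le (min_le_right _ _)⟩, ?_⟩
    exact_mod_cast (hu2.trans_le (min_le_left _ _)).le
  · have e : ((s - δ : ℝ) : EReal) < y.2 := coe_lt_of_lt_add (hs2.trans_le h3)
    obtain ⟨u, hu1, hu2⟩ := EReal.lt_iff_exists_real_btwn.1 (max_lt e hy)
    refine ⟨u, ⟨(le_max_right _ _).trans_lt hu1, hu2⟩, ?_⟩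
    have : s - δ < u := by exact_mod_cast (le_max_left _ _).trans_lt hu1
    linarith

theorem not_big_openI {δ : ℝ} {x : EReal × EReal} (h : ¬ bigP δ x) (t : ℝ) (ht : t ∈ openI x) :
    t + δ + δ ∉ openI x := by
  intro ht'
  apply h
  refine lt_of_le_of_lt (add_mono_r ht.1.le (δ + δ)) ?_
  rw [← EReal.coe_add, ← add_assoc]
  exact ht'.2

theorem interleaved_of_deltaMatching (k : Type) [Field k] {L L' : Type} (A : L → EReal × EReal)
    (B : L' → EReal × EReal) (hA : ∀ a, (A a).1 < (A a).2) (hB : ∀ b, (B b).1 < (B b).2)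
    (δ : ℝ) (hδ : 0 ≤ δ) (h : IsDeltaMatching A B (ENNReal.ofReal δ)) :
    Interleaved k (barMod k (fun a => openI (A a)) (fun _ => openI_conn _))
      (barMod k (fun b => openI (B b)) (fun _ => openI_conn _)) δ := by
  obtain ⟨M, hM, h1, h2, h3⟩ := h
  refine interleaved_of_matching _ _ _ _ M hM ?_ ?_ ?_
  · intro p hp
    have hn := (dPt_le_iff hδ _ _).1 (h1 p hp)
    exact ⟨nearSet_half (hB _) hn, nearSet_half (hA _) ⟨hn.1.symm, hn.2.symm⟩⟩
  · intro a ha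
    exact not_big_openI ((diagDist_le_iff hδ _ (hA a)).1 (h2 a ha))
  · intro b hb
    exact not_big_openI ((diagDist_le_iff hδ _ (hB b)).1 (h3 b hb))

theorem openI_locfin {k : Type} [Field k] (V : PersMod k ℝ) (hV : QTame k V) {ι : Type}
    (D : ι → (EReal × Bool) × (EReal × Bool)) (hD : IsDgmOf V D) (s t : ℝ) (h : s < t) :
    {i : {i : ι // (D i).1.1 < (D i).2.1} | s ∈ openI ((D i.1).1.1, (D i.1).2.1) ∧
      t ∈ openI ((D i.1).1.1, (D i.1).2.1)}.Finite := by
  have h1 := hV s t h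
  rw [erank_dgm hD h.le, Set.encard_ne_top_iff] at h1
  refine (h1.preimage (f := Subtype.val) Subtype.val_injective.injOn).subset ?_
  rintro i ⟨hs, ht⟩
  exact ⟨decMem_of_openI hs, decMem_of_openI ht⟩

theorem le_of_eps {a : ℝ≥0∞} {δ : ℝ} (hδ : 0 ≤ δ)
    (h : ∀ ε : ℝ, 0 < ε → a ≤ ENNReal.ofReal (6 * ε + δ + 6 * ε)) : a ≤ ENNReal.ofReal δ := by
  refine ENNReal.le_of_forall_pos_le_add fun ε hε _ => ?_
  have hε : (0 : ℝ) < ε := hε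
  have := h (ε / 12) (by positivity)
  refine this.trans (le_of_eq ?_)
  have e : 6 * ((ε : ℝ) / 12) + δ + 6 * ((ε : ℝ) / 12) = δ + ε := by ring
  rw [e, ENNReal.ofReal_add hδ hε.le, ENNReal.ofReal_coe_nnreal]

end Assembly

theorem stmt17 {k : Type} [Field k] (U V : PersMod k ℝ) (hU : QTame k U) (hV : QTame k V)
    {ι κ : Type} (DU : ι → (EReal × Bool) × (EReal × Bool))
    (DV : κ → (EReal × Bool) × (EReal × Bool))
    (hDU : IsDgmOf U DU) (hDV : IsDgmOf V DV) :
    dInter k U V =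
      dBottle
        (fun i : {i : ι // (DU i).1.1 < (DU i).2.1} => ((DU i.1).1.1, (DU i.1).2.1))
        (fun j : {j : κ // (DV j).1.1 < (DV j).2.1} => ((DV j.1).1.1, (DV j.1).2.1)) := by
  apply le_antisymm
  · refine le_sInf ?_
    rintro _ ⟨δ, hδ, hm, rfl⟩
    refine le_of_eps hδ fun ε hε => sInf_le ⟨_, by positivity, ?_, rfl⟩
    have h6 : 0 ≤ 6 * ε := by positivity
    have h6' : 0 ≤ 6 * ε + δ := by positivity
    have h1 := interleaved_key U hU DU hDU ε hε
    have h2 := interleaved_key V hV DV hDV ε hε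
    have h3 := interleaved_of_deltaMatching k _ _ (fun i => i.2) (fun j => j.2) δ hδ hm
    exact (h1.trans' h6 hδ h3).trans' h6' h6 h2.symm'
  · refine le_sInf ?_
    rintro _ ⟨δ, hδ, hm, rfl⟩
    refine le_of_eps hδ fun ε hε => sInf_le ⟨_, by positivity, ?_, rfl⟩
    have h6 : 0 ≤ 6 * ε := by positivity
    have h6' : 0 ≤ 6 * ε + δ := by positivity
    have h6'' : 0 ≤ 6 * ε + δ + 6 * ε := by positivity
    have h1 := interleaved_key U hU DU hDU ε hε
    have h2 := interleaved_key V hV DV hDV ε hε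
    have h3 := (h1.symm'.trans' h6 hδ hm).trans' h6' h6 h2
    exact matching_of_interleaved _ _ (fun i => i.2) (fun j => j.2)
      (openI_locfin U hU DU hDU) (openI_locfin V hV DV hDV) _ h6'' h3
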